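/- arXiv:1905.12142 — 8 statements merged into one kernel-verified Lean document; each statement's English description precedes it below -/
import Mathlib

section
/- For every d ∈ ℕ and p ∈ (0,1) there exists a constant C = C(d,p) > 0 such that the following holds for every n ∈ ℕ. Let f be a degree-d multilinear polynomial in n variables with nonnegative real coefficients, and let ξ ∈ Ber(p)ⁿ. Then for every x ∈ ℝ, Pr(|f(ξ) − x| < 1) ≤ C/√(r(f)). -/
open Filter Real
open scoped BigOperators Classical

/-- Probability of an event under the product Bernoulli(p) measure on `ι → Bool`. -/
noncomputable def bernoulliProb {ι : Type*} [Fintype ι] [DecidableEq ι] (p : ℝ)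
    (P : (ι → Bool) → Prop) : ℝ :=
  ∑ ω : ι → Bool, if P ω then (∏ i, if ω i then p else 1 - p) else 0

/-- `polyRank f` is the size of a largest matching in the hypergraph on `{1,…,n}`
whose hyperedges are the sets `{i₁,…,i_k}` such that the coefficient of
`x_{i₁}⋯x_{i_k}` in `f` has absolute value at least 1. -/
noncomputable def polyRank {n : ℕ} (f : MvPolynomial (Fin n) ℝ) : ℕ :=
  sSup {k : ℕ | ∃ M : Finset (Finset (Fin n)), M.card = k ∧
    (M : Set (Finset (Fin n))).Pairwise Disjoint ∧
    ∀ e ∈ M, e.Nonempty ∧ 1 ≤ |f.coeff (∑ i ∈ e, Finsupp.single i 1)|}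

/-- The weight of the outcome `ω` under the product Bernoulli(p) measure. -/
noncomputable def bernoulliWeight {ι : Type*} [Fintype ι] (p : ℝ) (ω : ι → Bool) : ℝ :=
  ∏ i, if ω i then p else 1 - p

lemma bernoulliWeight_nonneg {ι : Type*} [Fintype ι] {p : ℝ} (hp : 0 ≤ p) (hp1 : p ≤ 1)
    (ω : ι → Bool) : 0 ≤ bernoulliWeight p ω :=
  Finset.prod_nonneg fun i _ => by split_ifs <;> linarith

section

variable {ι : Type*} [Fintype ι] [DecidableEq ι] {p : ℝ}

lemma sum_bernoulliWeight (p : ℝ) : ∑ ω : ι → Bool, bernoulliWeight p ω = 1 := by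
  have h := Finset.prod_univ_sum (fun _ : ι => (Finset.univ : Finset Bool))
    (fun _ b => if b then p else 1 - p)
  simp only [Fintype.piFinset_univ] at h
  simp [bernoulliWeight, ← h]

/-- Conditioning on one coordinate amounts to overwriting it. -/
lemma sum_bernoulliWeight_update (p : ℝ) (F : (ι → Bool) → ℝ) (i : ι) (b : Bool) :
    ∑ ω, bernoulliWeight p ω * (if ω i = b then F ω else 0) =
      (if b then p else 1 - p) *
        ∑ ω, bernoulliWeight p ω * F (Function.update ω i b) := by
  have hw : ∀ (c : Bool) (η : {j // j ≠ i} → Bool),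
      bernoulliWeight p ((Equiv.funSplitAt i Bool).symm (c, η)) =
        (if c then p else 1 - p) * ∏ j, (if η j then p else 1 - p) := by
    intro c η
    rw [bernoulliWeight, Fintype.prod_eq_mul_prod_subtype_ne _ i]
    congr 1
    · simp
    · refine Finset.prod_congr rfl fun j _ => ?_
      simp [j.2]
  have hu : ∀ (c : Bool) (η : {j // j ≠ i} → Bool),
      Function.update ((Equiv.funSplitAt i Bool).symm (c, η)) i b =
        (Equiv.funSplitAt i Bool).symm (b, η) := by
    intro c η
    ext j
    by_cases hj : j = i
    · subst hj; simp
    · simp [hj]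
  have hi : ∀ (c : Bool) (η : {j // j ≠ i} → Bool),
      (Equiv.funSplitAt i Bool).symm (c, η) i = c := by
    intro c η; simp
  rw [← (Equiv.funSplitAt i Bool).symm.sum_comp, ← (Equiv.funSplitAt i Bool).symm.sum_comp,
    Fintype.sum_prod_type, Fintype.sum_prod_type]
  simp only [hw, hu, hi, Fintype.sum_bool]
  rw [← Finset.sum_add_distrib, ← Finset.sum_add_distrib, Finset.mul_sum]
  refine Finset.sum_congr rfl fun η _ => ?_
  cases b <;> simp <;> ring

/-- Conditioning on a block being constant amounts to overwriting the block. -/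
lemma sum_bernoulliWeight_piecewise (p : ℝ) (b : Bool) (e : Finset ι) (F : (ι → Bool) → ℝ) :
    ∑ ω, bernoulliWeight p ω * (if ∀ i ∈ e, ω i = b then F ω else 0) =
      (if b then p else 1 - p) ^ e.card *
        ∑ ω, bernoulliWeight p ω * F (e.piecewise (fun _ => b) ω) := by
  induction e using Finset.induction_on generalizing F with
  | empty => simp
  | insert a s ha ih =>
    have h1 : ∀ ω : ι → Bool, (if ∀ i ∈ insert a s, ω i = b then F ω else 0) =
        if ω a = b then (if ∀ i ∈ s, ω i = b then F ω else 0) else 0 := by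
      intro ω
      rw [← ite_and]
      simp only [Finset.forall_mem_insert]
    have h2 : ∀ ω : ι → Bool, (∀ i ∈ s, Function.update ω a b i = b) ↔ ∀ i ∈ s, ω i = b :=
      fun ω => forall₂_congr fun i hi => by
        rw [Function.update_of_ne (ne_of_mem_of_not_mem hi ha)]
    simp_rw [h1]
    rw [sum_bernoulliWeight_update p (fun ω => if ∀ i ∈ s, ω i = b then F ω else 0)]
    simp_rw [h2]
    rw [ih fun ω => F (Function.update ω a b), Finset.card_insert_of_notMem ha, pow_succ', mul_assoc]
    simp_rw [Finset.piecewise_insert]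

/-- The centered function of the block `e` which is dual to the discrete derivative that
compares the all-ones and the all-zeros configuration on `e`. -/
noncomputable def blockScore (p : ℝ) (e : Finset ι) (ω : ι → Bool) : ℝ :=
  (if ∀ i ∈ e, ω i = true then (p ^ e.card)⁻¹ else 0) -
    (if ∀ i ∈ e, ω i = false then ((1 - p) ^ e.card)⁻¹ else 0)

lemma sum_mul_blockScore (hp : 0 < p) (hp1 : p < 1) (e : Finset ι) (F : (ι → Bool) → ℝ) :
    ∑ ω, bernoulliWeight p ω * (F ω * blockScore p e ω) =
      ∑ ω, bernoulliWeight p ω *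
        (F (e.piecewise (fun _ => true) ω) - F (e.piecewise (fun _ => false) ω)) := by
  have hq : 0 < 1 - p := by linarith
  have h1 := sum_bernoulliWeight_piecewise p true e F
  have h0 := sum_bernoulliWeight_piecewise p false e F
  simp only [if_true, Bool.false_eq_true, if_false] at h1 h0
  simp_rw [mul_sub, Finset.sum_sub_distrib]
  rw [← inv_mul_eq_iff_eq_mul₀ (by positivity)] at h1 h0
  rw [← h1, ← h0, Finset.mul_sum, Finset.mul_sum, ← Finset.sum_sub_distrib]
  refine Finset.sum_congr rfl fun ω _ => ?_
  unfold blockScore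
  split_ifs <;> ring

lemma blockScore_piecewise_of_disjoint {e e' : Finset ι} (h : Disjoint e e') (b : Bool)
    (ω : ι → Bool) :
    blockScore p e' (e.piecewise (fun _ => b) ω) = blockScore p e' ω := by
  have key : ∀ c, (∀ i ∈ e', e.piecewise (fun _ => b) ω i = c) ↔ ∀ i ∈ e', ω i = c :=
    fun c => forall₂_congr fun i hi => by
      rw [Finset.piecewise_eq_of_notMem _ _ _ (Finset.disjoint_right.mp h hi)]
  simp only [blockScore, key]

lemma sum_blockScore_mul_of_disjoint (hp : 0 < p) (hp1 : p < 1) {e e' : Finset ι}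
    (h : Disjoint e e') :
    ∑ ω, bernoulliWeight p ω * (blockScore p e' ω * blockScore p e ω) = 0 := by
  rw [sum_mul_blockScore hp hp1]
  simp [blockScore_piecewise_of_disjoint h]

lemma sum_blockScore_mul_self (hp : 0 < p) (hp1 : p < 1) {e : Finset ι} (he : e.Nonempty) :
    ∑ ω, bernoulliWeight p ω * (blockScore p e ω * blockScore p e ω) =
      (p ^ e.card)⁻¹ + ((1 - p) ^ e.card)⁻¹ := by
  obtain ⟨a, ha⟩ := he
  have key : ∀ (b c : Bool) (ω : ι → Bool), (∀ i ∈ e, e.piecewise (fun _ => b) ω i = c) ↔ b = c := fun b c ω =>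
    ⟨fun h => by simpa [ha] using h a ha, fun h i hi => by simp [hi, h]⟩
  rw [sum_mul_blockScore hp hp1]
  simp only [blockScore, key]
  simp [← Finset.sum_mul, sum_bernoulliWeight]

lemma sum_sq_sum_blockScore_le (hp : 0 < p) (hp1 : p < 1) {d : ℕ} {M : Finset (Finset ι)}
    (hM : (M : Set (Finset ι)).Pairwise Disjoint) (hne : ∀ e ∈ M, e.Nonempty)
    (hd : ∀ e ∈ M, e.card ≤ d) :
    ∑ ω, bernoulliWeight p ω * (∑ e ∈ M, blockScore p e ω) ^ 2 ≤
      M.card * ((p ^ d)⁻¹ + ((1 - p) ^ d)⁻¹) := by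
  have hq : 0 < 1 - p := by linarith
  have h : ∑ ω, bernoulliWeight p ω * (∑ e ∈ M, blockScore p e ω) ^ 2 =
      ∑ e ∈ M, ∑ e' ∈ M,
        ∑ ω, bernoulliWeight p ω * (blockScore p e' ω * blockScore p e ω) := by
    simp_rw [sq, Finset.sum_mul_sum, Finset.mul_sum]
    rw [Finset.sum_comm]
    refine Finset.sum_congr rfl fun e _ => ?_
    rw [Finset.sum_comm]
    simp_rw [mul_comm (blockScore p e _)]
  rw [h, ← nsmul_eq_mul]
  refine Finset.sum_le_card_nsmul _ _ _ fun e he => ?_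
  rw [Finset.sum_eq_single_of_mem e he fun e' he' hne' =>
    sum_blockScore_mul_of_disjoint hp hp1 (hM he he' hne'.symm),
    sum_blockScore_mul_self hp hp1 (hne e he)]
  gcongr ?_⁻¹ + ?_⁻¹
  · exact pow_le_pow_of_le_one hp.le hp1.le (hd e he)
  · exact pow_le_pow_of_le_one hq.le (by linarith) (hd e he)

end

/-- A small ball estimate for a function on the cube which increases by at least `1` whenever
one of `M.card` disjoint blocks of size at most `d` switches from all zeros to all ones. -/
lemma bernoulliProb_mul_sqrt_card_le {ι : Type*} [Fintype ι] [DecidableEq ι] {p : ℝ}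
    (hp : 0 < p) (hp1 : p < 1) {d : ℕ} {M : Finset (Finset ι)}
    (hM : (M : Set (Finset ι)).Pairwise Disjoint) (hne : ∀ e ∈ M, e.Nonempty)
    (hd : ∀ e ∈ M, e.card ≤ d) {F : (ι → Bool) → ℝ} (hF : Monotone F)
    (hinc : ∀ e ∈ M, ∀ ω,
      F (e.piecewise (fun _ => false) ω) + 1 ≤ F (e.piecewise (fun _ => true) ω)) (x : ℝ) :
    bernoulliProb p (fun ω => |F ω - x| < 1) * √(M.card : ℝ) ≤
      √(4 * ((p ^ d)⁻¹ + ((1 - p) ^ d)⁻¹)) := by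
  have hq : 0 < 1 - p := by linarith
  set K := (p ^ d)⁻¹ + ((1 - p) ^ d)⁻¹ with hK
  have hK0 : 0 < K := by positivity
  set P := bernoulliProb p (fun ω => |F ω - x| < 1) with hP
  have hw : ∀ ω : ι → Bool, 0 ≤ bernoulliWeight p ω := bernoulliWeight_nonneg hp.le hp1.le
  have hP_eq : P = ∑ ω, bernoulliWeight p ω * (if |F ω - x| < 1 then 1 else 0) := by
    simp only [hP, bernoulliProb, bernoulliWeight, mul_ite, mul_one, mul_zero]
  have hP0 : 0 ≤ P := by
    rw [hP_eq]
    exact Finset.sum_nonneg fun ω _ => mul_nonneg (hw ω) (by split_ifs <;> norm_num)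
  set g : (ι → Bool) → ℝ := fun ω => max (-2) (min 2 (F ω - x)) with hg
  have hg2 : ∀ ω, g ω ^ 2 ≤ 4 := fun ω => by
    have h1 : -2 ≤ g ω := le_max_left _ _
    have h2 : g ω ≤ 2 := max_le (by norm_num) (min_le_left _ _)
    nlinarith
  have hlow : ∀ e ∈ M, P ≤ ∑ ω, bernoulliWeight p ω * (g ω * blockScore p e ω) := by
    intro e he
    rw [sum_mul_blockScore hp hp1, hP_eq]
    refine Finset.sum_le_sum fun ω _ => mul_le_mul_of_nonneg_left ?_ (hw ω)
    have h0 : F (e.piecewise (fun _ => false) ω) ≤ F ω := hF fun i => by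
      by_cases hi : i ∈ e <;> simp [hi]
    have h1 : F ω ≤ F (e.piecewise (fun _ => true) ω) := hF fun i => by
      by_cases hi : i ∈ e <;> simp [hi, Bool.le_true]
    have h2 := hinc e he ω
    simp only [hg]
    split_ifs with h
    · rw [abs_lt] at h
      grind
    · exact sub_nonneg.mpr (max_le_max le_rfl (min_le_min le_rfl (by linarith)))
  have hsum : M.card * P ≤ ∑ ω, bernoulliWeight p ω * (g ω * ∑ e ∈ M, blockScore p e ω) := by
    simp_rw [Finset.mul_sum]
    rw [Finset.sum_comm, ← nsmul_eq_mul]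
    exact Finset.card_nsmul_le_sum _ _ _ hlow
  have hCS : (∑ ω, bernoulliWeight p ω * (g ω * ∑ e ∈ M, blockScore p e ω)) ^ 2 ≤
      (∑ ω, bernoulliWeight p ω * g ω ^ 2) *
        ∑ ω, bernoulliWeight p ω * (∑ e ∈ M, blockScore p e ω) ^ 2 :=
    Finset.sum_sq_le_sum_mul_sum_of_sq_le_mul _
      (fun ω _ => mul_nonneg (hw ω) (sq_nonneg _))
      (fun ω _ => mul_nonneg (hw ω) (sq_nonneg _)) fun ω _ => le_of_eq (by ring)
  have hg4 : ∑ ω, bernoulliWeight p ω * g ω ^ 2 ≤ 4 := by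
    calc ∑ ω, bernoulliWeight p ω * g ω ^ 2 ≤ ∑ ω : ι → Bool, bernoulliWeight p ω * 4 :=
          Finset.sum_le_sum fun ω _ => mul_le_mul_of_nonneg_left (hg2 ω) (hw ω)
      _ = 4 := by rw [← Finset.sum_mul, sum_bernoulliWeight, one_mul]
  have hS := sum_sq_sum_blockScore_le hp hp1 hM hne hd
  have hfin : (M.card * P) ^ 2 ≤ 4 * (M.card * K) :=
    calc (M.card * P) ^ 2 ≤ _ := pow_le_pow_left₀ (by positivity) hsum 2
      _ ≤ _ := hCS
      _ ≤ 4 * (M.card * K) := mul_le_mul hg4 hS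
          (Finset.sum_nonneg fun ω _ => mul_nonneg (hw ω) (sq_nonneg _)) (by norm_num)
  refine Real.le_sqrt_of_sq_le ?_
  rw [mul_pow, Real.sq_sqrt (Nat.cast_nonneg _)]
  rcases Nat.eq_zero_or_pos M.card with h | h
  · rw [h]; simp only [Nat.cast_zero, mul_zero]; positivity
  · have hr : (0 : ℝ) < M.card := by exact_mod_cast h
    refine le_of_mul_le_mul_left ?_ hr
    linarith

section

variable {n : ℕ} {f : MvPolynomial (Fin n) ℝ}

lemma exists_matching_card_eq_polyRank (f : MvPolynomial (Fin n) ℝ) :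
    ∃ M : Finset (Finset (Fin n)), M.card = polyRank f ∧
      (M : Set (Finset (Fin n))).Pairwise Disjoint ∧
      ∀ e ∈ M, e.Nonempty ∧ 1 ≤ |f.coeff (∑ i ∈ e, Finsupp.single i 1)| := by
  refine Nat.sSup_mem (s := {k : ℕ | ∃ M : Finset (Finset (Fin n)), M.card = k ∧
    (M : Set (Finset (Fin n))).Pairwise Disjoint ∧
    ∀ e ∈ M, e.Nonempty ∧ 1 ≤ |f.coeff (∑ i ∈ e, Finsupp.single i 1)|}) ⟨0, ∅, by simp⟩
    ⟨Fintype.card (Finset (Fin n)), ?_⟩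
  rintro k ⟨M, rfl, -⟩
  exact Finset.card_le_univ M

lemma card_le_totalDegree_of_coeff_ne_zero {e : Finset (Fin n)}
    (h : f.coeff (∑ i ∈ e, Finsupp.single i 1) ≠ 0) : e.card ≤ f.totalDegree := by
  have := MvPolynomial.le_totalDegree (MvPolynomial.mem_support_iff.mpr h)
  simpa [← Finsupp.degree_eq_sum, Finsupp.degree_apply, Finsupp.sum_fintype,
    Finsupp.finsetSum_apply, Finsupp.single_apply] using this

lemma monotone_eval_boolean (hf : ∀ m, 0 ≤ f.coeff m) :
    Monotone fun ω : Fin n → Bool =>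
      MvPolynomial.eval (fun i => if ω i then (1 : ℝ) else 0) f := by
  intro ω η h
  simp only [MvPolynomial.eval_eq']
  refine Finset.sum_le_sum fun m _ => mul_le_mul_of_nonneg_left ?_ (hf m)
  refine Finset.prod_le_prod (fun i _ => by positivity) fun i _ => ?_
  gcongr
  have : ω i ≤ η i := h i
  cases hω : ω i <;> cases hη : η i <;> rw [hω, hη] at this
  case true.false => exact absurd this (by decide)
  all_goals simp

lemma eval_piecewise_add_one_le (hf : ∀ m, 0 ≤ f.coeff m) {e : Finset (Fin n)}
    (he : e.Nonempty) (hc : 1 ≤ f.coeff (∑ i ∈ e, Finsupp.single i 1)) (ω : Fin n → Bool) :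
    MvPolynomial.eval
        (fun i => if e.piecewise (fun _ => false) ω i then (1 : ℝ) else 0) f + 1 ≤
      MvPolynomial.eval (fun i => if e.piecewise (fun _ => true) ω i then (1 : ℝ) else 0) f := by
  obtain ⟨a, ha⟩ := he
  set m₀ : Fin n →₀ ℕ := ∑ i ∈ e, Finsupp.single i 1 with hm₀
  have hm : ∀ i, m₀ i = if i ∈ e then 1 else 0 := fun i => by
    simp [hm₀, Finsupp.finsetSum_apply, Finsupp.single_apply]
  have hsplit : f = (f - MvPolynomial.monomial m₀ 1) + MvPolynomial.monomial m₀ 1 := by ring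
  have hmono := monotone_eval_boolean (f := f - MvPolynomial.monomial m₀ 1) fun m => by
    rw [MvPolynomial.coeff_sub, MvPolynomial.coeff_monomial]
    split_ifs with h
    · subst h; linarith
    · linarith [hf m]
  have hle : e.piecewise (fun _ => false) ω ≤ e.piecewise (fun _ => true) ω := fun i => by
    by_cases hi : i ∈ e <;> simp [hi]
  have h0 : MvPolynomial.eval (fun i => if e.piecewise (fun _ => false) ω i then (1 : ℝ) else 0)
      (MvPolynomial.monomial m₀ 1) = 0 := by
    rw [MvPolynomial.eval_monomial, Finsupp.prod_fintype _ _ (by simp), one_mul]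
    exact Finset.prod_eq_zero (Finset.mem_univ a) (by simp [ha, hm])
  have h1 : MvPolynomial.eval (fun i => if e.piecewise (fun _ => true) ω i then (1 : ℝ) else 0)
      (MvPolynomial.monomial m₀ 1) = 1 := by
    rw [MvPolynomial.eval_monomial, Finsupp.prod_fintype _ _ (by simp), one_mul]
    refine Finset.prod_eq_one fun i _ => ?_
    by_cases hi : i ∈ e <;> simp [hi, hm]
  rw [hsplit, map_add, map_add, h0, h1, add_zero]
  exact add_le_add_left (hmono hle) 1

end

/-- For every `d` and `p ∈ (0,1)` there is `C > 0` such that for every `n`, every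
degree-`d` multilinear polynomial `f` in `n` variables with nonnegative coefficients
and every `x ∈ ℝ`, `Pr(|f(ξ) - x| < 1) ≤ C / √(r(f))` (written multiplicatively so
that the statement is also the correct trivial statement when `r(f) = 0`). -/
theorem positive_polynomial_LO (d : ℕ) (p : ℝ) (hp : 0 < p) (hp1 : p < 1) :
    ∃ C > 0, ∀ (n : ℕ) (f : MvPolynomial (Fin n) ℝ),
      (∀ m ∈ f.support, ∀ i, m i ≤ 1) →
      f.totalDegree ≤ d →
      (∀ m, 0 ≤ f.coeff m) →
      ∀ x : ℝ,
        bernoulliProb p (fun ω : Fin n → Bool =>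
            |MvPolynomial.eval (fun i => if ω i then (1:ℝ) else 0) f - x| < 1)
          * Real.sqrt (polyRank f) ≤ C := by
  have hq : 0 < 1 - p := by linarith
  refine ⟨√(4 * ((p ^ d)⁻¹ + ((1 - p) ^ d)⁻¹)), by positivity, fun n f _ hdeg hf x => ?_⟩
  obtain ⟨M, hcard, hM, hcoeff⟩ := exists_matching_card_eq_polyRank f
  have hone : ∀ e ∈ M, 1 ≤ f.coeff (∑ i ∈ e, Finsupp.single i 1) := fun e he => by
    simpa only [abs_of_nonneg (hf _)] using (hcoeff e he).2
  rw [← hcard]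
  exact bernoulliProb_mul_sqrt_card_le hp hp1 hM (fun e he => (hcoeff e he).1)
    (fun e he => (card_le_totalDegree_of_coeff_ne_zero
      (zero_lt_one.trans_le (hone e he)).ne').trans hdeg)
    (monotone_eval_boolean hf)
    (fun e he ω => eval_piecewise_add_one_le hf (hcoeff e he).1 (hone e he) ω) x
end

section
/- Suppose n/k → ∞. Then for any integer r ≥ 1, any r-uniform hypergraph G on n vertices, and any ℓ ≠ 0, one has Pr(X_{G,k}^{Ber} = ℓ) ≤ 1/e + o(1), where the o(1) term depends only on n/k and tends to 0 as n/k → ∞. -/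
open Filter Real
open scoped BigOperators Classical

/-- The number of hyperedges of the hypergraph `G` (on vertex set `Fin n`) that are
fully contained in the random vertex subset encoded by `ω`. -/
noncomputable def edgeStat {n : ℕ} (G : Finset (Finset (Fin n)))
    (ω : Fin n → Bool) : ℕ :=
  (G.filter (fun e => ∀ i ∈ e, ω i = true)).card

/-- Probability that `f A = ℓ` when `A` is a random subset of `S` containing each element
independently with probability `p`. -/
noncomputable def subsetProb {α : Type*} (p : ℝ) (S : Finset α) (f : Finset α → ℤ) (ℓ : ℤ) : ℝ :=
  ∑ A ∈ S.powerset, if f A = ℓ then p ^ A.card * (1 - p) ^ (S.card - A.card) else 0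

theorem subsetProb_insert {α : Type*} [DecidableEq α] (p : ℝ) {v : α} {T : Finset α} (hv : v ∉ T)
    (f : Finset α → ℤ) (ℓ c : ℤ) :
    subsetProb p (insert v T) f ℓ = (1 - p) * subsetProb p T f ℓ +
      p * subsetProb p T (fun A => f (insert v A) - c) (ℓ - c) := by
  unfold subsetProb
  rw [Finset.sum_powerset_insert hv, Finset.mul_sum, Finset.mul_sum]
  congr 1
  · refine Finset.sum_congr rfl fun A hA => ?_
    have hle := Finset.card_le_card (Finset.mem_powerset.1 hA)
    rw [Finset.card_insert_of_notMem hv, Nat.succ_sub hle, mul_ite, mul_zero]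
    congr 1
    rw [Nat.succ_eq_add_one, pow_succ]
    ring
  · refine Finset.sum_congr rfl fun A hA => ?_
    have hvA : v ∉ A := fun h => hv (Finset.mem_powerset.1 hA h)
    rw [Finset.card_insert_of_notMem hv, Finset.card_insert_of_notMem hvA,
      Nat.add_sub_add_right, mul_ite, mul_zero]
    simp only [sub_left_inj]
    congr 1
    ring

/-- If every singleton has value `ℓ ≠ 0`, only singletons have value `ℓ`. -/
theorem card_eq_one_of_supermodular {α : Type*} [DecidableEq α] {S : Finset α}
    {f : Finset α → ℤ} {ℓ : ℤ} (hmono : Monotone f)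
    (hsup : ∀ A B, f A + f B ≤ f (A ∪ B) + f (A ∩ B)) (h0 : f ∅ = 0) (hℓ : ℓ ≠ 0)
    (hS : ∀ v ∈ S, f {v} = ℓ) {A : Finset α} (hA : A ⊆ S) (hf : f A = ℓ) : A.card = 1 := by
  have hne : A.Nonempty := by
    rw [Finset.nonempty_iff_ne_empty]
    rintro rfl
    exact hℓ (hf.symm.trans h0)
  refine le_antisymm ?_ hne.card_pos
  by_contra! hlt
  obtain ⟨a, ha, b, hb, hab⟩ := Finset.one_lt_card.1 hlt
  have h1 := hsup {a} {b}
  rw [Finset.singleton_inter_of_notMem (by simpa using hab), hS a (hA ha), hS b (hA hb), h0] at h1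
  have h2 : f ({a} ∪ {b}) ≤ f A := hmono (by
    intro x hx
    simp only [Finset.mem_union, Finset.mem_singleton] at hx
    rcases hx with rfl | rfl <;> assumption)
  have h3 : f ∅ ≤ f {a} := hmono (Finset.empty_subset _)
  rw [hS a (hA ha), h0] at h3
  omega

theorem subsetProb_le {α : Type*} [DecidableEq α] {p C : ℝ} (hp0 : 0 ≤ p) (hp1 : p ≤ 1)
    (hC : ∀ m : ℕ, m * (p * (1 - p) ^ (m - 1)) ≤ C) (S : Finset α) (f : Finset α → ℤ) (ℓ : ℤ)
    (hmono : Monotone f) (hsup : ∀ A B, f A + f B ≤ f (A ∪ B) + f (A ∩ B)) (h0 : f ∅ = 0)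
    (hℓ : ℓ ≠ 0) : subsetProb p S f ℓ ≤ C := by
  induction S using Finset.strongInduction generalizing f ℓ with
  | H S ih =>
    by_cases h : ∃ v ∈ S, f {v} ≠ ℓ
    · obtain ⟨v, hvS, hv⟩ := h
      have hlt := Finset.erase_ssubset hvS
      rw [← Finset.insert_erase hvS, subsetProb_insert p (Finset.notMem_erase v S) f ℓ (f {v})]
      have h1 := ih _ hlt f ℓ hmono hsup h0 hℓ
      have h2 := ih _ hlt (fun A => f (insert v A) - f {v}) (ℓ - f {v})
        (fun A B hAB => sub_le_sub_right (hmono (Finset.insert_subset_insert v hAB)) _)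
        (fun A B => by
          have := hsup (insert v A) (insert v B)
          rw [← Finset.insert_union_distrib, ← Finset.insert_inter_distrib] at this
          linarith)
        (by simp) (sub_ne_zero.2 hv.symm)
      nlinarith [mul_le_mul_of_nonneg_left h1 (sub_nonneg.2 hp1), mul_le_mul_of_nonneg_left h2 hp0]
    · push Not at h
      refine le_trans ?_ (hC S.card)
      have hq : 0 ≤ 1 - p := sub_nonneg.2 hp1
      calc subsetProb p S f ℓ
          ≤ ∑ A ∈ S.powerset, if A.card = 1 then p * (1 - p) ^ (S.card - 1) else 0 := by
            refine Finset.sum_le_sum fun A hA => ?_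
            by_cases hf : f A = ℓ
            · have := card_eq_one_of_supermodular hmono hsup h0 hℓ h (Finset.mem_powerset.1 hA) hf
              simp [hf, this]
            · rw [if_neg hf]
              split_ifs <;> positivity
        _ = S.card * (p * (1 - p) ^ (S.card - 1)) := by
            rw [← Finset.sum_filter, ← Finset.powersetCard_eq_filter, Finset.sum_const,
              Finset.card_powersetCard, Nat.choose_one_right, nsmul_eq_mul]

theorem nat_mul_bernoulli_le_exp {p : ℝ} (hp1 : p ≤ 1) (m : ℕ) :
    m * (p * (1 - p) ^ (m - 1)) ≤ exp (p - 1) := by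
  rcases m with _ | m
  · simp [exp_nonneg]
  have h1 : ((m + 1 : ℕ) : ℝ) * p ≤ exp ((m + 1) * p - 1) := by
    have := add_one_le_exp (((m : ℝ) + 1) * p - 1)
    push_cast
    linarith
  have h2 : (1 - p) ^ m ≤ exp (m * -p) := by
    rw [exp_nat_mul]
    exact pow_le_pow_left₀ (sub_nonneg.2 hp1) (one_sub_le_exp_neg p) m
  calc ((m + 1 : ℕ) : ℝ) * (p * (1 - p) ^ (m + 1 - 1))
      = ((m + 1 : ℕ) * p) * (1 - p) ^ m := by rw [Nat.add_sub_cancel]; ring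
    _ ≤ exp ((m + 1) * p - 1) * exp (m * -p) :=
        mul_le_mul h1 h2 (pow_nonneg (sub_nonneg.2 hp1) m) (exp_nonneg _)
    _ = exp (p - 1) := by rw [← exp_add]; ring_nf

theorem bernoulliProb_eq_subsetProb {n : ℕ} (p : ℝ) (G : Finset (Finset (Fin n))) (ℓ : ℕ) :
    bernoulliProb p (fun ω : Fin n → Bool => edgeStat G ω = ℓ) =
      subsetProb p Finset.univ (fun A => ((G.filter (· ⊆ A)).card : ℤ)) ℓ := by
  unfold bernoulliProb subsetProb
  refine Finset.sum_nbij' (fun ω => Finset.univ.filter (fun i => ω i = true))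
    (fun A i => decide (i ∈ A)) (by simp) (by simp) (by intro ω _; ext i; simp)
    (by intro A _; ext i; simp) fun ω _ => ?_
  have hf : G.filter (· ⊆ Finset.univ.filter (fun i => ω i = true)) =
      G.filter (fun e => ∀ i ∈ e, ω i = true) := by
    ext e
    simp [Finset.subset_iff]
  have hw : ∏ i, (if ω i = true then p else 1 - p) =
      p ^ (Finset.univ.filter (fun i => ω i = true)).card *
        (1 - p) ^ ((Finset.univ : Finset (Fin n)).card -
          (Finset.univ.filter (fun i => ω i = true)).card) := by
    rw [Finset.prod_ite, Finset.prod_const, Finset.prod_const, Finset.filter_not,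
      Finset.card_sdiff_of_subset (Finset.filter_subset _ _)]
  beta_reduce
  rw [hf, hw]
  by_cases h : edgeStat G ω = ℓ
  · rw [if_pos h, if_pos (by exact_mod_cast h)]
  · rw [if_neg h, if_neg (by exact_mod_cast h)]

theorem card_filter_subset_supermodular {α : Type*} [DecidableEq α] (G : Finset (Finset α))
    (A B : Finset α) :
    (G.filter (· ⊆ A)).card + (G.filter (· ⊆ B)).card ≤
      (G.filter (· ⊆ A ∪ B)).card + (G.filter (· ⊆ A ∩ B)).card := by
  rw [← Finset.card_union_add_card_inter]
  refine add_le_add (Finset.card_le_card fun e he => ?_) (Finset.card_le_card fun e he => ?_)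
  · simp only [Finset.mem_union, Finset.mem_filter] at he ⊢
    rcases he with ⟨hG, he⟩ | ⟨hG, he⟩
    · exact ⟨hG, he.trans Finset.subset_union_left⟩
    · exact ⟨hG, he.trans Finset.subset_union_right⟩
  · simp only [Finset.mem_inter, Finset.mem_filter] at he ⊢
    exact ⟨he.1.1, Finset.subset_inter he.1.2 he.2.2⟩

/-- The point probabilities of the edge statistic away from `0` are at most `exp (p - 1)`. -/
theorem bernoulliProb_edgeStat_le {n : ℕ} {p : ℝ} (hp0 : 0 ≤ p) (hp1 : p ≤ 1)
    (G : Finset (Finset (Fin n))) (hG : ∅ ∉ G) {ℓ : ℕ} (hℓ : ℓ ≠ 0) :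
    bernoulliProb p (fun ω : Fin n → Bool => edgeStat G ω = ℓ) ≤ exp (p - 1) := by
  rw [bernoulliProb_eq_subsetProb]
  refine subsetProb_le hp0 hp1 (nat_mul_bernoulli_le_exp hp1) _ _ _ ?_ ?_ ?_
    (by exact_mod_cast hℓ)
  · intro A B hAB
    beta_reduce
    exact_mod_cast Finset.card_le_card
      (Finset.monotone_filter_right G fun e _ (he : e ⊆ A) => he.trans hAB)
  · intro A B
    exact_mod_cast card_filter_subset_supermodular G A B
  · simp only [Finset.subset_empty, Nat.cast_eq_zero, Finset.card_eq_zero]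
    exact Finset.filter_eq_empty_iff.2 fun e he h => hG (h ▸ he)

/-- Proposition 1.5: if `n/k → ∞` then for any `r ≥ 1`, any `r`-uniform hypergraph `G`
on `n` vertices and any `ℓ ≠ 0`, `Pr(X_{G,k}^{Ber} = ℓ) ≤ 1/e + o(1)`, where the `o(1)`
term depends only on `n/k`.  Each vertex is kept independently with probability `k/n`. -/
theorem bernoulli_one_over_e :
    ∀ ε : ℝ, 0 < ε → ∃ R : ℝ, ∀ (n k r : ℕ) (G : Finset (Finset (Fin n))) (ℓ : ℕ),
      (∀ e ∈ G, e.card = r) →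
      1 ≤ r → ℓ ≠ 0 → 1 ≤ k → k ≤ n →
      R ≤ (n : ℝ) / k →
      bernoulliProb ((k : ℝ) / n) (fun ω : Fin n → Bool => edgeStat G ω = ℓ)
        ≤ 1 / Real.exp 1 + ε := by
  intro ε hε
  have hlim : Tendsto (fun R : ℝ => exp (R⁻¹ - 1)) atTop (nhds (exp (0 - 1))) :=
    (continuous_exp.tendsto _).comp (tendsto_inv_atTop_zero.sub_const 1)
  obtain ⟨R, hR, hR0⟩ := ((hlim.eventually_lt_const (lt_add_of_pos_right _ hε)).and
    (eventually_gt_atTop 0)).exists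
  refine ⟨R, fun n k r G ℓ hG hr hℓ hk hkn hRn => ?_⟩
  have hn : (0 : ℝ) < n := by exact_mod_cast hk.trans hkn
  have hp1 : (k : ℝ) / n ≤ 1 := (div_le_one hn).2 (by exact_mod_cast hkn)
  have hpR : (k : ℝ) / n ≤ R⁻¹ := by
    rw [← inv_div]
    exact inv_anti₀ hR0 hRn
  have hempty : ∅ ∉ G := fun h => by
    have := hG _ h
    rw [Finset.card_empty] at this
    omega
  calc bernoulliProb ((k : ℝ) / n) (fun ω : Fin n → Bool => edgeStat G ω = ℓ)
      ≤ exp ((k : ℝ) / n - 1) := bernoulliProb_edgeStat_le (by positivity) hp1 G hempty hℓ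
    _ ≤ exp (R⁻¹ - 1) := exp_le_exp.2 (sub_le_sub_right hpR 1)
    _ ≤ 1 / exp 1 + ε := by
        rw [one_div, ← exp_neg, ← zero_sub]
        exact hR.le
end

section
/- There is a function g : (0,1) → ℝ with g(p) → 0 as p → 0 such that the following holds. For every n ∈ ℕ, every (a₁,…,aₙ) ∈ ℝⁿ, every p ∈ (0,1), and every x ≠ 0: with ξ ∈ Ber(p)ⁿ and X := a₁ξ₁ + ⋯ + aₙξₙ, one has Pr(X = x) ≤ 1/e + g(p). -/
open Filter Real
open scoped BigOperators Classical

/-- Conditioning on the `i`-th coordinate. -/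
theorem bernoulliProb_eq_insertNth {n : ℕ} (p : ℝ) (i : Fin (n + 1))
    (P : (Fin (n + 1) → Bool) → Prop) :
    bernoulliProb p P =
      p * bernoulliProb p (fun ω : Fin n → Bool => P (i.insertNth (α := fun _ => Bool) true ω)) +
      (1 - p) *
        bernoulliProb p (fun ω : Fin n → Bool => P (i.insertNth (α := fun _ => Bool) false ω)) := by
  unfold bernoulliProb
  rw [← (Fin.insertNthEquiv (fun _ => Bool) i).sum_comp, Fintype.sum_prod_type,
    Fintype.sum_bool, Finset.mul_sum, Finset.mul_sum]
  simp [Fin.insertNthEquiv, Fin.prod_univ_succAbove _ i]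

/-- The probability that `∑ i, a i * ξ i = x` for `ξ ∈ Ber(p)ⁿ`. -/
noncomputable def bernoulliSumProb {n : ℕ} (p : ℝ) (a : Fin n → ℝ) (x : ℝ) : ℝ :=
  bernoulliProb p (fun ω : Fin n → Bool => (∑ i, a i * (if ω i then (1 : ℝ) else 0)) = x)

theorem bernoulliSumProb_eq_succAbove {n : ℕ} (p : ℝ) (a : Fin (n + 1) → ℝ) (x : ℝ)
    (i : Fin (n + 1)) :
    bernoulliSumProb p a x =
      p * bernoulliSumProb p (fun j => a (i.succAbove j)) (x - a i) +
      (1 - p) * bernoulliSumProb p (fun j => a (i.succAbove j)) x := by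
  unfold bernoulliSumProb
  rw [bernoulliProb_eq_insertNth p i]
  simp [Fin.sum_univ_succAbove _ i, eq_sub_iff_add_eq']

theorem bernoulliSumProb_const_zero (n : ℕ) (p : ℝ) {x : ℝ} (hx : x ≠ 0) :
    bernoulliSumProb p (fun _ : Fin n => x) 0 = (1 - p) ^ n := by
  have key (ω : Fin n → Bool) :
      (∑ i, x * (if ω i then (1 : ℝ) else 0)) = 0 ↔ ω = fun _ => false := by
    rw [← Finset.mul_sum, mul_eq_zero_iff_left hx,
      Finset.sum_eq_zero_iff_of_nonneg (fun i _ => by split_ifs <;> norm_num)]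
    simp [funext_iff]
  simp only [bernoulliSumProb, bernoulliProb, key]
  simp

theorem bernoulliSumProb_const_self (n : ℕ) (p : ℝ) {x : ℝ} (hx : x ≠ 0) :
    bernoulliSumProb p (fun _ : Fin n => x) x = n * p * (1 - p) ^ (n - 1) := by
  induction n with
  | zero => simp [bernoulliSumProb, bernoulliProb, hx.symm]
  | succ n ih =>
    rw [bernoulliSumProb_eq_succAbove p _ x 0, sub_self, bernoulliSumProb_const_zero n p hx, ih]
    cases n with
    | zero => simp
    | succ m =>
      push_cast
      ring

theorem mul_mul_one_sub_pow_le_exp (n : ℕ) {p : ℝ} (hp1 : p < 1) :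
    n * p * (1 - p) ^ (n - 1) ≤ Real.exp (p - 1) := by
  cases n with
  | zero => simpa using (Real.exp_pos _).le
  | succ m =>
    have h₁ : (1 - p) ^ m ≤ Real.exp (-(m * p)) := by
      calc (1 - p) ^ m ≤ Real.exp (-p) ^ m :=
            pow_le_pow_left₀ (by linarith) (Real.one_sub_le_exp_neg p) m
        _ = Real.exp (-(m * p)) := by rw [← Real.exp_nat_mul]; ring_nf
    have h₂ : ((m + 1 : ℕ) : ℝ) * p ≤ Real.exp ((m + 1 : ℕ) * p - 1) := by
      linarith [Real.add_one_le_exp (((m + 1 : ℕ) : ℝ) * p - 1)]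
    calc ((m + 1 : ℕ) : ℝ) * p * (1 - p) ^ m
        ≤ Real.exp ((m + 1 : ℕ) * p - 1) * Real.exp (-(m * p)) :=
          mul_le_mul h₂ h₁ (pow_nonneg (by linarith) m) (Real.exp_pos _).le
      _ = Real.exp (p - 1) := by
          rw [← Real.exp_add]
          push_cast
          ring_nf

/-- If some coefficient differs from `x`, conditioning on it leaves nonzero targets for the
remaining sum; otherwise the event is that a binomial variable equals `1`. -/
theorem bernoulliSumProb_le_exp {n : ℕ} (a : Fin n → ℝ) {p : ℝ} (hp : 0 < p) (hp1 : p < 1)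
    {x : ℝ} (hx : x ≠ 0) : bernoulliSumProb p a x ≤ Real.exp (p - 1) := by
  by_cases h : ∀ i, a i = x
  · obtain rfl : a = fun _ => x := funext h
    rw [bernoulliSumProb_const_self n p hx]
    exact mul_mul_one_sub_pow_le_exp n hp1
  · obtain ⟨i, hi⟩ := not_forall.mp h
    cases n with
    | zero => exact i.elim0
    | succ n =>
      rw [bernoulliSumProb_eq_succAbove p a x i]
      have h₁ := bernoulliSumProb_le_exp (fun j => a (i.succAbove j)) hp hp1
        (sub_ne_zero.mpr (Ne.symm hi))
      have h₂ := bernoulliSumProb_le_exp (fun j => a (i.succAbove j)) hp hp1 hx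
      nlinarith [mul_le_mul_of_nonneg_left h₁ hp.le,
        mul_le_mul_of_nonneg_left h₂ (sub_nonneg.mpr hp1.le)]

/-- Theorem 1.6 (Poisson-type Littlewood–Offord): there is `g : (0,1) → ℝ` with
`g(p) → 0` as `p → 0⁺` such that for every `n`, every `(a₁,…,aₙ) ∈ ℝⁿ`, every
`p ∈ (0,1)` and every `x ≠ 0`, with `X = a₁ξ₁ + ⋯ + aₙξₙ` and `ξ ∈ Ber(p)ⁿ`,
`Pr(X = x) ≤ 1/e + g(p)`. -/
theorem poisson_LO :
    ∃ g : ℝ → ℝ, Tendsto g (nhdsWithin 0 (Set.Ioi 0)) (nhds 0) ∧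
      ∀ (n : ℕ) (a : Fin n → ℝ) (p : ℝ), 0 < p → p < 1 → ∀ x : ℝ, x ≠ 0 →
        bernoulliProb p (fun ω : Fin n → Bool =>
            (∑ i, a i * (if ω i then (1:ℝ) else 0)) = x)
          ≤ 1 / Real.exp 1 + g p := by
  refine ⟨fun p => Real.exp (p - 1) - 1 / Real.exp 1, ?_, fun n a p hp hp1 x hx => ?_⟩
  · have h : Continuous fun p : ℝ => Real.exp (p - 1) - 1 / Real.exp 1 := by fun_prop
    have h₀ := h.tendsto 0
    rw [zero_sub, Real.exp_neg, one_div, sub_self] at h₀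
    simpa only [one_div] using h₀.mono_left nhdsWithin_le_nhds
  · have := bernoulliSumProb_le_exp a hp hp1 hx
    unfold bernoulliSumProb at this
    linarith
end

section
/- Let f be a real polynomial in n variables of degree at most d, let p ∈ (0,1] with p ≤ 1/2, and let ξ ∈ Ber(p)ⁿ. Then for any x ∈ ℝ not equal to the constant coefficient of f, Pr(f(ξ) = x) ≤ 1 − 2^{−d}. -/
open Filter Real
open scoped BigOperators Classical

lemma bernoulliProb_fin_succ {n : ℕ} (p : ℝ) (P : (Fin (n + 1) → Bool) → Prop) :
    bernoulliProb p P = p * bernoulliProb p (fun ω : Fin n → Bool => P (Fin.cons true ω)) +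
      (1 - p) * bernoulliProb p (fun ω : Fin n → Bool => P (Fin.cons false ω)) := by
  unfold bernoulliProb
  rw [← (Fin.consEquiv (fun _ : Fin (n + 1) => Bool)).sum_comp, Fintype.sum_prod_type,
    Fintype.sum_bool, Finset.mul_sum, Finset.mul_sum]
  simp [Fin.consEquiv, Fin.prod_univ_succ]

lemma bernoulliProb_le_add {ι : Type*} [Fintype ι] [DecidableEq ι] {p : ℝ} (hp : 0 ≤ p)
    (hp1 : p ≤ 1) {P Q R : (ι → Bool) → Prop} (h : ∀ ω, P ω → Q ω ∨ R ω) :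
    bernoulliProb p P ≤ bernoulliProb p Q + bernoulliProb p R := by
  unfold bernoulliProb
  rw [← Finset.sum_add_distrib]
  refine Finset.sum_le_sum fun ω _ => ?_
  have hw : 0 ≤ ∏ i, if ω i then p else 1 - p :=
    Finset.prod_nonneg fun i _ => by split_ifs <;> linarith
  have := h ω
  split_ifs <;> first | linarith | tauto

lemma bernoulliProb_true (n : ℕ) (p : ℝ) :
    bernoulliProb p (fun _ : Fin n → Bool => True) = 1 := by
  induction n with
  | zero => simp [bernoulliProb]
  | succ n ih => rw [bernoulliProb_fin_succ, ih]; ring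

lemma bernoulliProb_add_not {n : ℕ} (p : ℝ) (P : (Fin n → Bool) → Prop) :
    bernoulliProb p P + bernoulliProb p (fun ω => ¬ P ω) = 1 := by
  rw [← bernoulliProb_true n p]
  unfold bernoulliProb
  rw [← Finset.sum_add_distrib]
  refine Finset.sum_congr rfl fun ω _ => ?_
  by_cases h : P ω <;> simp [h]

lemma MvPolynomial.totalDegree_eval_one_le {n k : ℕ}
    {F : Polynomial (MvPolynomial (Fin n) ℝ)} (h : ∀ i, (F.coeff i).totalDegree ≤ k) :
    (F.eval 1).totalDegree ≤ k := by
  rw [Polynomial.eval_eq_sum_range]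
  refine MvPolynomial.totalDegree_finsetSum_le fun i _ => ?_
  simpa using h i

/-- A polynomial of degree at most `d` with nonzero constant coefficient is nonzero at a
`Ber(p)` point with probability at least `2⁻ᵈ`. -/
lemma one_div_two_pow_le_bernoulliProb_eval_ne_zero {p : ℝ} (hp : 0 ≤ p) (hp2 : p ≤ 1 / 2)
    (n d : ℕ) (f : MvPolynomial (Fin n) ℝ) (hd : f.totalDegree ≤ d)
    (h0 : MvPolynomial.eval 0 f ≠ 0) :
    1 / 2 ^ d ≤ bernoulliProb p (fun ω : Fin n → Bool =>
      MvPolynomial.eval (fun i => if ω i then (1 : ℝ) else 0) f ≠ 0) := by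
  induction n generalizing d with
  | zero =>
    have h : ∀ ω : Fin 0 → Bool,
        MvPolynomial.eval (fun i => if ω i then (1 : ℝ) else 0) f ≠ 0 := fun ω => by
      rwa [Subsingleton.elim (fun i => if ω i then (1 : ℝ) else 0) 0]
    rw [show (fun ω : Fin 0 → Bool =>
      MvPolynomial.eval (fun i => if ω i then (1 : ℝ) else 0) f ≠ 0) = fun _ => True from
        funext fun ω => eq_true (h ω), bernoulliProb_true]
    exact div_le_one_of_le₀ (one_le_pow₀ one_le_two) (by positivity)
  | succ n ih =>
    set F := MvPolynomial.finSuccEquiv ℝ n f with hF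
    set a := F.coeff 0 with ha
    set b := F.divX.eval 1 with hb
    have hsum : F.eval 1 = b + a := by
      conv_lhs => rw [← F.divX_mul_X_add]
      simp [hb, ha]
    have hdeg : ∀ i, (F.coeff i).totalDegree ≤ d - i := fun i => by
      by_cases hi : F.coeff i = 0
      · simp [hi]
      · have := MvPolynomial.totalDegree_coeff_finSuccEquiv_add_le f i hi
        rw [← hF] at this
        omega
    have heval (y : ℝ) (s : Fin n → ℝ) :
        MvPolynomial.eval (Fin.cons y s) f = (F.map (MvPolynomial.eval s)).eval y :=
      MvPolynomial.eval_eq_eval_mv_eval' s y f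
    have heval0 (s : Fin n → ℝ) :
        MvPolynomial.eval (Fin.cons 0 s) f = MvPolynomial.eval s a := by
      rw [heval, ← Polynomial.coeff_zero_eq_eval_zero, Polynomial.coeff_map]
    have heval1 (s : Fin n → ℝ) :
        MvPolynomial.eval (Fin.cons 1 s) f = MvPolynomial.eval s (b + a) := by
      rw [heval, Polynomial.eval_one_map, hsum]
    have hcons (c : Bool) (ω : Fin n → Bool) :
        (fun i => if (Fin.cons c ω : Fin (n + 1) → Bool) i then (1 : ℝ) else 0) =
          Fin.cons (if c then 1 else 0) (fun i => if ω i then (1 : ℝ) else 0) := by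
      funext i
      cases i using Fin.cases <;> simp
    have ha0 : MvPolynomial.eval 0 a ≠ 0 := by
      rw [← heval0]
      convert h0
      funext i
      cases i using Fin.cases <;> simp
    have hA := ih d a (hdeg 0) ha0
    rw [bernoulliProb_fin_succ]
    simp only [hcons, if_true, Bool.false_eq_true, if_false, heval0, heval1]
    by_cases hba : MvPolynomial.eval 0 (b + a) = 0
    · have hb0 : MvPolynomial.eval 0 b ≠ 0 := fun h => ha0 (by rwa [map_add, h, zero_add] at hba)
      have hbdeg : b.totalDegree ≤ d - 1 := MvPolynomial.totalDegree_eval_one_le fun i => by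
        rw [Polynomial.coeff_divX]
        exact (hdeg _).trans (by omega)
      have hd1 : d ≠ 0 := by
        rintro rfl
        have hdiv : F.divX = 0 := by
          ext1 i
          rw [Polynomial.coeff_divX, Polynomial.coeff_zero]
          by_contra hi
          have := MvPolynomial.totalDegree_coeff_finSuccEquiv_add_le f (i + 1) hi
          omega
        exact hb0 (by simp [hb, hdiv])
      obtain ⟨e, rfl⟩ := Nat.exists_eq_add_one_of_ne_zero hd1
      have hB := (ih e b hbdeg hb0).trans (bernoulliProb_le_add hp (by linarith)
        (Q := fun ω => MvPolynomial.eval (fun i => if ω i then (1 : ℝ) else 0) (b + a) ≠ 0)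
        (R := fun ω => MvPolynomial.eval (fun i => if ω i then (1 : ℝ) else 0) a ≠ 0)
        fun ω h => by
          by_contra! hc
          exact h (by simpa [hc.2] using hc.1))
      have h2 : (1 : ℝ) / 2 ^ e = 2 * (1 / 2 ^ (e + 1)) := by
        rw [pow_succ]; field_simp
      rw [h2] at hB
      linarith [mul_le_mul_of_nonneg_left hB hp,
        mul_le_mul_of_nonneg_left hA (show 0 ≤ 1 - 2 * p by linarith)]
    · have hS := ih d (b + a)
        (hsum ▸ MvPolynomial.totalDegree_eval_one_le fun i => (hdeg i).trans (Nat.sub_le d i)) hba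
      nlinarith

/-- Proposition 1.7: if `f` is an `n`-variable real polynomial of degree at most `d`,
`0 < p ≤ 1/2`, and `ξ ∈ Ber(p)ⁿ`, then for any `x` not equal to the constant
coefficient of `f`, `Pr(f(ξ) = x) ≤ 1 - 2^{-d}`. -/
theorem weak_bound (n d : ℕ) (f : MvPolynomial (Fin n) ℝ)
    (hd : f.totalDegree ≤ d) (p : ℝ) (hp : 0 < p) (hp2 : p ≤ 1 / 2)
    (x : ℝ) (hx : x ≠ f.coeff 0) :
    bernoulliProb p (fun ω : Fin n → Bool =>
        MvPolynomial.eval (fun i => if ω i then (1:ℝ) else 0) f = x)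
      ≤ 1 - 1 / 2 ^ d := by
  have hdeg : (f - MvPolynomial.C x).totalDegree ≤ d :=
    (MvPolynomial.totalDegree_sub_C_le f x).trans hd
  have h0 : MvPolynomial.eval 0 (f - MvPolynomial.C x) ≠ 0 := by
    have : MvPolynomial.eval 0 f = f.coeff 0 := by
      rw [MvPolynomial.eval_zero, MvPolynomial.constantCoeff_eq]
    rw [map_sub, MvPolynomial.eval_C, this]
    exact sub_ne_zero.mpr hx.symm
  have h := one_div_two_pow_le_bernoulliProb_eval_ne_zero hp.le hp2 n d _ hdeg h0
  simp only [map_sub, MvPolynomial.eval_C, sub_ne_zero] at h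
  have := bernoulliProb_add_not p (fun ω : Fin n → Bool =>
    MvPolynomial.eval (fun i => if ω i then (1 : ℝ) else 0) f = x)
  linarith
end

section
/- There is a function g : (0,1) → ℝ with g(p) → 0 as p → 0 such that the following holds. For every n ∈ ℕ, every real polynomial f in n variables all of whose coefficients are nonnegative, every p ∈ (0,1), and every x ∈ ℝ not equal to the constant coefficient of f: with ξ ∈ Ber(p)ⁿ, one has Pr(f(ξ) = x) ≤ 1/e + g(p). (No bound on the degree of f is assumed.) -/
open Filter Real
open scoped BigOperators Classical

/-- The elements outside `D` which, added to the part of `D` below them, make `F` equal to `x`. -/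
noncomputable def entryPoints {ι : Type*} [Fintype ι] [LinearOrder ι] (F : Finset ι → ℝ) (x : ℝ)
    (D : Finset ι) : Finset ι :=
  Finset.univ.filter fun j => j ∉ D ∧ F (insert j (D.filter (· < j))) = x

lemma mem_entryPoints {ι : Type*} [Fintype ι] [LinearOrder ι] {F : Finset ι → ℝ} {x : ℝ}
    {D : Finset ι} {j : ι} :
    j ∈ entryPoints F x D ↔ j ∉ D ∧ F (insert j (D.filter (· < j))) = x := by
  simp [entryPoints]

lemma disjoint_of_subset_entryPoints {ι : Type*} [Fintype ι] [LinearOrder ι] {F : Finset ι → ℝ}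
    {x : ℝ} {D J : Finset ι} (hJ : J ⊆ entryPoints F x D) : Disjoint D J :=
  Finset.disjoint_right.2 fun _ hj => (mem_entryPoints.1 (hJ hj)).1

lemma eq_of_union_eq_union {ι : Type*} [Fintype ι] [LinearOrder ι] {F : Finset ι → ℝ} {x : ℝ}
    (hF : Monotone F) {D D' J J' : Finset ι} (hD : F D < x) (hD' : F D' < x)
    (hJ : J ⊆ entryPoints F x D) (hJ' : J' ⊆ entryPoints F x D') (h : D ∪ J = D' ∪ J') :
    J = J' := by
  have hdJ : ∀ i, i ∈ D → i ∉ J :=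
    fun _ => (Finset.disjoint_left.1 (disjoint_of_subset_entryPoints hJ) ·)
  have hdJ' : ∀ i, i ∈ D' → i ∉ J' :=
    fun _ => (Finset.disjoint_left.1 (disjoint_of_subset_entryPoints hJ') ·)
  have hu : ∀ i, i ∈ D ∨ i ∈ J ↔ i ∈ D' ∨ i ∈ J' := fun i => by
    simpa using Finset.ext_iff.1 h i
  ext l
  induction l using WellFoundedLT.induction with
  | ind l ih =>
    have hfilter : D.filter (· < l) = D'.filter (· < l) := by
      ext i
      simp only [Finset.mem_filter]
      refine and_congr_left fun hi => ?_
      have h1 := ih i hi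
      have h2 := hu i
      have h3 := hdJ i
      have h4 := hdJ' i
      tauto
    have key : ∀ {D J D' J' : Finset ι}, F D' < x → J ⊆ entryPoints F x D →
        D.filter (· < l) = D'.filter (· < l) → (l ∈ J → l ∈ D' ∨ l ∈ J') → l ∈ J → l ∈ J' := by
      intro D J D' J' hD' hJ he hl hlJ
      refine (hl hlJ).resolve_left fun hlD' => ?_
      have hx := (mem_entryPoints.1 (hJ hlJ)).2
      have hle : F (insert l (D.filter (· < l))) ≤ F D' := by
        rw [he]
        exact hF (Finset.insert_subset hlD' (Finset.filter_subset _ _))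
      linarith
    exact ⟨key hD' hJ hfilter fun hl => (hu l).1 (Or.inr hl),
      key hD hJ' hfilter.symm fun hl => (hu l).2 (Or.inr hl)⟩

lemma exists_entryPoint {ι : Type*} [Fintype ι] [LinearOrder ι] {F : Finset ι → ℝ} {x : ℝ}
    (hF : Monotone F)
    (hsuper : ∀ (A B : Finset ι) (i : ι), A ⊆ B → i ∉ B →
      F (insert i A) - F A ≤ F (insert i B) - F B)
    (h0 : F ∅ < x) {C : Finset ι} (hC : F C = x) :
    ∃ D j, F D < x ∧ j ∈ entryPoints F x D ∧ insert j D = C := by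
  have hmax : ∃ j ∈ C, F (insert j (C.filter (· < j))) = x := by
    have hne : C.Nonempty := by
      rw [Finset.nonempty_iff_ne_empty]
      rintro rfl
      exact h0.ne hC
    refine ⟨C.max' hne, C.max'_mem hne, ?_⟩
    convert hC using 2
    ext i
    simp only [Finset.mem_insert, Finset.mem_filter]
    constructor
    · rintro (rfl | h)
      exacts [C.max'_mem hne, h.1]
    · intro h
      rcases (C.le_max' i h).eq_or_lt with h' | h'
      exacts [Or.inl h', Or.inr ⟨h, h'⟩]
  obtain ⟨j, ⟨hjC, hj⟩, hmin⟩ := WellFounded.has_min (wellFounded_lt (α := ι))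
    {j | j ∈ C ∧ F (insert j (C.filter (· < j))) = x} hmax
  have hlt : F (C.filter (· < j)) < x := by
    refine lt_of_le_of_ne (hC ▸ hF (Finset.filter_subset _ _)) fun heq => ?_
    have hne : (C.filter (· < j)).Nonempty := by
      rw [Finset.nonempty_iff_ne_empty]
      intro h
      rw [h] at heq
      exact h0.ne heq
    have hk := Finset.max'_mem _ hne
    set k := (C.filter (· < j)).max' hne
    rw [Finset.mem_filter] at hk
    refine hmin k ⟨hk.1, ?_⟩ hk.2
    rw [← heq]
    congr 1
    ext i
    simp only [Finset.mem_insert, Finset.mem_filter]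
    constructor
    · rintro (rfl | h)
      exacts [hk, ⟨h.1, h.2.trans hk.2⟩]
    · intro h
      rcases (Finset.le_max' (C.filter (· < j)) i (Finset.mem_filter.2 h)).eq_or_lt with h' | h'
      exacts [Or.inl h', Or.inr ⟨h.1, h'⟩]
  have hfilter : (C.erase j).filter (· < j) = C.filter (· < j) := by
    ext i
    simp only [Finset.mem_filter, Finset.mem_erase]
    exact ⟨fun h => ⟨h.1.2, h.2⟩, fun h => ⟨⟨h.2.ne, h.1⟩, h.2⟩⟩
  refine ⟨C.erase j, j, ?_, mem_entryPoints.2 ⟨Finset.notMem_erase j C, by rw [hfilter, hj]⟩,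
    Finset.insert_erase hjC⟩
  have h := hsuper (C.filter (· < j)) (C.erase j) j (hfilter ▸ Finset.filter_subset _ _)
    (Finset.notMem_erase j C)
  rw [Finset.insert_erase hjC, hj, hC] at h
  linarith

/-- The weight of a level set of a monotone supermodular set function is at most `c` times the
total weight, as soon as `c` dominates the mass at one of every unnormalised binomial law. -/
theorem sum_pow_card_level_le {ι : Type*} [Fintype ι] [LinearOrder ι] {F : Finset ι → ℝ} {x : ℝ}
    (hF : Monotone F)
    (hsuper : ∀ (A B : Finset ι) (i : ι), A ⊆ B → i ∉ B →
      F (insert i A) - F A ≤ F (insert i B) - F B)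
    (h0 : F ∅ < x) {r c : ℝ} (hr : 0 ≤ r) (hc : 0 ≤ c)
    (hN : ∀ N : ℕ, N * r ≤ c * (1 + r) ^ N) :
    ∑ C with F C = x, r ^ C.card ≤ c * (1 + r) ^ Fintype.card ι := by
  set low : Finset (Finset ι) := Finset.univ.filter fun D => F D < x with hlow
  have hmem : ∀ D, D ∈ low ↔ F D < x := by simp [hlow]
  calc ∑ C with F C = x, r ^ C.card
      ≤ ∑ C ∈ (low.sigma fun D => entryPoints F x D).image (fun q => insert q.2 q.1),
          r ^ C.card := by
        refine Finset.sum_le_sum_of_subset_of_nonneg ?_ fun _ _ _ => pow_nonneg hr _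
        intro C hC
        obtain ⟨D, j, hD, hj, rfl⟩ :=
          exists_entryPoint hF hsuper h0 (Finset.mem_filter.1 hC).2
        exact Finset.mem_image.2 ⟨⟨D, j⟩, Finset.mem_sigma.2 ⟨(hmem D).2 hD, hj⟩, rfl⟩
    _ ≤ ∑ q ∈ low.sigma fun D => entryPoints F x D, r ^ (insert q.2 q.1).card :=
        Finset.sum_image_le_of_nonneg fun _ _ => pow_nonneg hr _
    _ = ∑ D ∈ low, r ^ D.card * ((entryPoints F x D).card * r) := by
        rw [Finset.sum_sigma]
        refine Finset.sum_congr rfl fun D _ => ?_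
        rw [Finset.sum_congr rfl (g := fun _ => r ^ D.card * r) fun j hj => by
          rw [Finset.card_insert_of_notMem (mem_entryPoints.1 hj).1, pow_succ]]
        rw [Finset.sum_const, nsmul_eq_mul]
        ring
    _ ≤ ∑ D ∈ low, r ^ D.card * (c * (1 + r) ^ (entryPoints F x D).card) :=
        Finset.sum_le_sum fun D _ => mul_le_mul_of_nonneg_left (hN _) (pow_nonneg hr _)
    _ = c * ∑ q ∈ low.sigma fun D => (entryPoints F x D).powerset, r ^ (q.1 ∪ q.2).card := by
        rw [Finset.sum_sigma, Finset.mul_sum]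
        refine Finset.sum_congr rfl fun D _ => ?_
        rw [Finset.sum_congr rfl (g := fun J => r ^ D.card * r ^ J.card) fun J hJ => by
          rw [Finset.card_union_of_disjoint
            (disjoint_of_subset_entryPoints (Finset.mem_powerset.1 hJ)), pow_add]]
        rw [← Finset.mul_sum, add_comm 1 r, ← Finset.sum_pow_mul_eq_add_pow]
        simp only [one_pow, mul_one]
        ring
    _ = c * ∑ S ∈ (low.sigma fun D => (entryPoints F x D).powerset).image
          (fun q => q.1 ∪ q.2), r ^ S.card := by
        rw [Finset.sum_image]
        rintro ⟨D, J⟩ hq ⟨D', J'⟩ hq' h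
        simp only [Finset.coe_sigma, Set.mem_sigma_iff, Finset.mem_coe, hmem,
          Finset.mem_powerset] at hq hq' h
        obtain rfl := eq_of_union_eq_union hF hq.1 hq'.1 hq.2 hq'.2 h
        have hD : D = D' := by
          rw [← Finset.union_sdiff_cancel_right (disjoint_of_subset_entryPoints hq.2), h,
            Finset.union_sdiff_cancel_right (disjoint_of_subset_entryPoints hq'.2)]
        rw [hD]
    _ ≤ c * ∑ S : Finset ι, r ^ S.card := by
        refine mul_le_mul_of_nonneg_left ?_ hc
        exact Finset.sum_le_sum_of_subset_of_nonneg (Finset.subset_univ _)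
          fun _ _ _ => pow_nonneg hr _
    _ = c * (1 + r) ^ Fintype.card ι := by
        rw [add_comm 1 r, ← Fintype.sum_pow_mul_eq_add_pow]
        simp

lemma nat_mul_odds_le {p : ℝ} (hp : p < 1) (N : ℕ) :
    N * (p / (1 - p)) ≤ Real.exp p / Real.exp 1 * (1 + p / (1 - p)) ^ N := by
  have hq : 0 < 1 - p := by linarith
  have h1 : 1 + p / (1 - p) = (1 - p)⁻¹ := by field_simp; ring
  rcases N with _ | N
  · simp only [Nat.cast_zero, zero_mul, pow_zero]
    positivity
  have hy : (N + 1) * p ≤ Real.exp ((N + 1) * p - 1) := by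
    linarith [Real.add_one_le_exp ((N + 1) * p - 1)]
  have hpow : (1 - p) ^ N ≤ Real.exp (-(N * p)) := by
    rw [← mul_neg, Real.exp_nat_mul]
    exact pow_le_pow_left₀ hq.le (by linarith [Real.add_one_le_exp (-p)]) N
  have hmain : (N + 1) * p * (1 - p) ^ N ≤ Real.exp p / Real.exp 1 := by
    calc (N + 1) * p * (1 - p) ^ N
        ≤ Real.exp ((N + 1) * p - 1) * Real.exp (-(N * p)) :=
          mul_le_mul hy hpow (pow_nonneg hq.le N) (Real.exp_pos _).le
      _ = Real.exp p / Real.exp 1 := by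
          rw [← Real.exp_add, ← Real.exp_sub]
          ring_nf
  rw [h1, inv_pow, ← div_eq_mul_inv, le_div_iff₀ (pow_pos hq _), pow_succ]
  calc ((N + 1 : ℕ) : ℝ) * (p / (1 - p)) * ((1 - p) ^ N * (1 - p))
      = (N + 1) * (p / (1 - p) * (1 - p)) * (1 - p) ^ N := by push_cast; ring
    _ ≤ Real.exp p / Real.exp 1 := by rwa [div_mul_cancel₀ _ hq.ne']

lemma eval_indicator_eq_sum {σ : Type*} [DecidableEq σ] (f : MvPolynomial σ ℝ) (S : Finset σ) :
    MvPolynomial.eval (fun i => if i ∈ S then (1 : ℝ) else 0) f =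
      ∑ m ∈ f.support, if m.support ⊆ S then f.coeff m else 0 := by
  rw [MvPolynomial.eval_eq]
  refine Finset.sum_congr rfl fun m _ => ?_
  split_ifs with h
  · rw [Finset.prod_eq_one fun i hi => by rw [if_pos (h hi), one_pow], mul_one]
  · obtain ⟨i, hi, hiS⟩ := Finset.not_subset.1 h
    rw [Finset.prod_eq_zero hi, mul_zero]
    rw [if_neg hiS, zero_pow (Finsupp.mem_support_iff.1 hi)]

lemma monotone_eval_indicator {σ : Type*} [DecidableEq σ] {f : MvPolynomial σ ℝ}
    (hf : ∀ m, 0 ≤ f.coeff m) :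
    Monotone fun S : Finset σ => MvPolynomial.eval (fun i => if i ∈ S then (1 : ℝ) else 0) f := by
  intro A B hAB
  simp only [eval_indicator_eq_sum]
  refine Finset.sum_le_sum fun m _ => ?_
  by_cases h : m.support ⊆ A
  · rw [if_pos h, if_pos (h.trans hAB)]
  · rw [if_neg h]
    split_ifs
    exacts [hf m, le_rfl]

lemma supermodular_eval_indicator {σ : Type*} [DecidableEq σ] {f : MvPolynomial σ ℝ}
    (hf : ∀ m, 0 ≤ f.coeff m) {A B : Finset σ} {i : σ} (hAB : A ⊆ B) (hi : i ∉ B) :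
    MvPolynomial.eval (fun k => if k ∈ insert i A then (1 : ℝ) else 0) f -
        MvPolynomial.eval (fun k => if k ∈ A then (1 : ℝ) else 0) f ≤
      MvPolynomial.eval (fun k => if k ∈ insert i B then (1 : ℝ) else 0) f -
        MvPolynomial.eval (fun k => if k ∈ B then (1 : ℝ) else 0) f := by
  simp only [eval_indicator_eq_sum, ← Finset.sum_sub_distrib]
  refine Finset.sum_le_sum fun m _ => ?_
  have hm := hf m
  have hA : m.support ⊆ A → m.support ⊆ insert i A := fun h => h.trans (Finset.subset_insert _ _)
  have hB : m.support ⊆ B → m.support ⊆ insert i B := fun h => h.trans (Finset.subset_insert _ _)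
  have hiA : m.support ⊆ insert i A → m.support ⊆ insert i B := fun h =>
    h.trans (Finset.insert_subset_insert i hAB)
  have hmix : m.support ⊆ insert i A → m.support ⊆ B → m.support ⊆ A := fun h h' k hk =>
    (Finset.mem_insert.1 (h hk)).resolve_left fun hki => hi (hki ▸ h' hk)
  split_ifs <;> first | (exfalso; tauto) | linarith

lemma bernoulliProb_eq_sum_finset {ι : Type*} [Fintype ι] [DecidableEq ι] {p : ℝ} (hp : p < 1)
    (P : (ι → Bool) → Prop) :
    bernoulliProb p P = (1 - p) ^ Fintype.card ι *
      ∑ S : Finset ι with P (fun i => decide (i ∈ S)), (p / (1 - p)) ^ S.card := by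
  have hq : 1 - p ≠ 0 := by linarith
  rw [bernoulliProb, Finset.sum_filter, Finset.mul_sum]
  refine Finset.sum_nbij' (fun ω => Finset.univ.filter fun i => ω i = true)
    (fun S i => decide (i ∈ S)) (by simp) (by simp) (by simp) (by simp) fun ω _ => ?_
  simp only [Finset.mem_filter, Finset.mem_univ, true_and, Bool.decide_eq_true]
  split_ifs
  · have hprod : ∀ i, (if ω i = true then p else 1 - p) =
        (1 - p) * if ω i = true then p / (1 - p) else 1 := fun i => by
      split_ifs
      · field_simp
      · ring
    rw [Finset.prod_congr rfl fun i _ => hprod i, Finset.prod_mul_distrib, Finset.prod_const,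
      Finset.card_univ, Finset.prod_ite, Finset.prod_const, Finset.prod_const_one, mul_one]
  · simp

/-- Theorem 1.8: there is `g : (0,1) → ℝ` with `g(p) → 0` as `p → 0⁺` such that for
every `n`, every `n`-variable real polynomial `f` with nonnegative coefficients (of
arbitrary degree), every `p ∈ (0,1)`, and every `x` not equal to the constant
coefficient of `f`, with `ξ ∈ Ber(p)ⁿ` we have `Pr(f(ξ) = x) ≤ 1/e + g(p)`. -/
theorem poisson_nonnegative :
    ∃ g : ℝ → ℝ, Tendsto g (nhdsWithin 0 (Set.Ioi 0)) (nhds 0) ∧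
      ∀ (n : ℕ) (f : MvPolynomial (Fin n) ℝ), (∀ m, 0 ≤ f.coeff m) →
        ∀ p : ℝ, 0 < p → p < 1 → ∀ x : ℝ, x ≠ f.coeff 0 →
          bernoulliProb p (fun ω : Fin n → Bool =>
              MvPolynomial.eval (fun i => if ω i then (1:ℝ) else 0) f = x)
            ≤ 1 / Real.exp 1 + g p := by
  refine ⟨fun p => Real.exp p / Real.exp 1 - 1 / Real.exp 1, ?_, ?_⟩
  · have hcont : Continuous fun p : ℝ => Real.exp p / Real.exp 1 - 1 / Real.exp 1 := by fun_prop
    have h := hcont.tendsto 0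
    simp only [Real.exp_zero, sub_self] at h
    exact h.mono_left nhdsWithin_le_nhds
  intro n f hf p hp0 hp1 x hx
  have hq : 0 < 1 - p := by linarith
  rw [add_sub_cancel, bernoulliProb_eq_sum_finset hp1]
  simp only [decide_eq_true_eq]
  set F : Finset (Fin n) → ℝ :=
    fun S => MvPolynomial.eval (fun i => if i ∈ S then (1 : ℝ) else 0) f with hFdef
  have hmono : Monotone F := monotone_eval_indicator hf
  have hF0 : F ∅ = f.coeff 0 := by
    simp only [hFdef, Finset.notMem_empty, if_false]
    exact DFunLike.congr_fun MvPolynomial.eval_zero' f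
  rcases lt_or_gt_of_ne hx with h | h
  · rw [Finset.sum_eq_zero, mul_zero]
    · positivity
    · intro S hS
      have hS' : F S = x := (Finset.mem_filter.1 hS).2
      have := hmono (Finset.empty_subset S)
      linarith
  · have hbound := sum_pow_card_level_le hmono
      (fun A B i hAB hi => supermodular_eval_indicator hf hAB hi) (hF0 ▸ h)
      (div_nonneg hp0.le hq.le) (by positivity) (nat_mul_odds_le hp1)
    calc _ ≤ (1 - p) ^ Fintype.card (Fin n) *
          (Real.exp p / Real.exp 1 * (1 + p / (1 - p)) ^ Fintype.card (Fin n)) := by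
          refine mul_le_mul_of_nonneg_left ?_ (pow_nonneg hq.le _)
          convert hbound
      _ = Real.exp p / Real.exp 1 := by
          rw [mul_left_comm, ← mul_pow]
          have h1 : (1 - p) * (1 + p / (1 - p)) = 1 := by field_simp; ring
          rw [h1, one_pow, mul_one]
end

section
/- Let f be a multilinear real polynomial in n variables of degree exactly d with d ≥ 1, and let ξ ∈ Ber(1/2)ⁿ. Then for every ℓ ∈ ℝ, Pr(f(ξ) = ℓ) ≤ 1 − 2^{−d}. -/
open Filter Real
open scoped BigOperators Classical

/-- The signed sum of a monomial over a subcube with free coordinates `M` factors; it vanishes as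
soon as the monomial misses a free coordinate. -/
lemma signed_subcube_sum_monomial {n : ℕ} (M : Finset (Fin n)) (η : Fin n → Bool)
    (m : Fin n → ℕ) :
    ∑ ω ∈ Fintype.piFinset (fun i => if i ∈ M then (Finset.univ : Finset Bool) else {η i}),
      (∏ i, if i ∈ M ∧ ω i = false then (-1 : ℝ) else 1) *
        ∏ i, (if ω i then (1 : ℝ) else 0) ^ m i
      = ∏ i, if i ∈ M then 1 - (0 : ℝ) ^ m i else (if η i then (1 : ℝ) else 0) ^ m i := by
  simp_rw [← Finset.prod_mul_distrib]
  rw [← Finset.prod_univ_sum (fun i => if i ∈ M then (Finset.univ : Finset Bool) else {η i})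
    (fun i b => (if i ∈ M ∧ b = false then (-1 : ℝ) else 1) * (if b then (1 : ℝ) else 0) ^ m i)]
  refine Finset.prod_congr rfl fun i _ => ?_
  by_cases hi : i ∈ M
  · simp [hi, sub_eq_add_neg]
  · simp [hi]

/-- If `m₀` is multilinear and of maximal degree among the monomials of `f`, then every subcube
whose free coordinates are the variables of `m₀` contains a point where `f` differs from `ℓ`. -/
lemma exists_eval_ne_on_subcube {n : ℕ} (f : MvPolynomial (Fin n) ℝ) (m₀ : Fin n →₀ ℕ)
    (hm₀ : m₀ ∈ f.support) (hlin : ∀ i, m₀ i ≤ 1) (hne : m₀.support.Nonempty)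
    (hmax : ∀ m ∈ f.support, ∑ i, m i ≤ ∑ i, m₀ i) (ℓ : ℝ) (η : Fin n → Bool) :
    ∃ ω : Fin n → Bool, (∀ i, i ∉ m₀.support → ω i = η i) ∧
      MvPolynomial.eval (fun i => if ω i then (1 : ℝ) else 0) f ≠ ℓ := by
  by_contra! hcon
  set M := m₀.support with hM
  set t : Fin n → Finset Bool := fun i => if i ∈ M then Finset.univ else {η i} with ht
  set s : (Fin n → Bool) → ℝ := fun ω => ∏ i, if i ∈ M ∧ ω i = false then (-1 : ℝ) else 1
    with hs
  have hagree : ∀ ω ∈ Fintype.piFinset t, ∀ i, i ∉ M → ω i = η i := by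
    intro ω hω i hi
    simpa [ht, hi] using Fintype.mem_piFinset.1 hω i
  have hvanish : ∑ ω ∈ Fintype.piFinset t,
      s ω * MvPolynomial.eval (fun i => if ω i then (1 : ℝ) else 0) f = 0 := by
    have hsum := signed_subcube_sum_monomial M η (fun _ => 0)
    obtain ⟨i, hi⟩ := hne
    rw [Finset.prod_eq_zero (Finset.mem_univ i) (by simp [hi])] at hsum
    simp only [pow_zero, Finset.prod_const_one, mul_one] at hsum
    rw [Finset.sum_congr rfl fun ω hω => by rw [hcon ω (hagree ω hω)], ← Finset.sum_mul, hsum,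
      zero_mul]
  simp_rw [MvPolynomial.eval_eq', Finset.mul_sum] at hvanish
  rw [Finset.sum_comm] at hvanish
  simp_rw [mul_left_comm (s _), ← Finset.mul_sum] at hvanish
  simp only [hs, ht, signed_subcube_sum_monomial] at hvanish
  rw [Finset.sum_eq_single_of_mem m₀ hm₀] at hvanish
  · refine MvPolynomial.mem_support_iff.1 hm₀ ((mul_eq_zero.1 hvanish).resolve_right ?_)
    refine Finset.prod_ne_zero_iff.2 fun i _ => ?_
    by_cases hi : i ∈ M
    · simp [hi, Finsupp.mem_support_iff.1 hi]
    · simp [hi, Finsupp.notMem_support_iff.1 hi]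
  · intro m hm hmne
    obtain ⟨i, hi, hmi⟩ : ∃ i ∈ M, m i = 0 := by
      by_contra! hpos
      have hle : ∀ i ∈ Finset.univ, m₀ i ≤ m i := by
        intro i _
        by_cases hi : i ∈ M
        · exact (hlin i).trans (Nat.one_le_iff_ne_zero.2 (hpos i hi))
        · simp [Finsupp.notMem_support_iff.1 hi]
      have heq := (Finset.sum_eq_sum_iff_of_le hle).1
        (le_antisymm (Finset.sum_le_sum hle) (hmax m hm))
      exact hmne (Finsupp.ext fun i => (heq i (Finset.mem_univ i)).symm)
    rw [Finset.prod_eq_zero (Finset.mem_univ i) (by simp [hi, hmi]), mul_zero]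

/-- A set of points of the cube that meets every subcube with free coordinates `M` has density at
least `2⁻ᵏ`, where `k = #M`. -/
lemma two_pow_le_card_mul_of_meets_subcubes {n : ℕ} (M : Finset (Fin n))
    (B : Finset (Fin n → Bool))
    (hB : ∀ η : Fin n → Bool, ∃ ω ∈ B, ∀ i, i ∉ M → ω i = η i) :
    2 ^ n ≤ B.card * 2 ^ M.card := by
  choose b hb hagree using hB
  have hinj : Function.Injective
      fun η : Fin n → Bool => ((⟨b η, hb η⟩, fun i => η i) : B × (M → Bool)) := by
    intro η η' h
    obtain ⟨h₁, h₂⟩ := Prod.mk.inj h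
    funext i
    by_cases hi : i ∈ M
    · exact congrFun h₂ ⟨i, hi⟩
    · rw [← hagree η i hi, ← hagree η' i hi, Subtype.mk.inj h₁]
  simpa using Fintype.card_le_of_injective _ hinj

/-- Under the unbiased measure, the probability of an event is its density in the cube. -/
lemma bernoulliProb_half {n : ℕ} (P : (Fin n → Bool) → Prop) :
    bernoulliProb (1 / 2 : ℝ) P
      = 1 - ((Finset.univ.filter fun ω => ¬ P ω).card : ℝ) / 2 ^ n := by
  have hweight : ∀ ω : Fin n → Bool,
      (∏ i, if ω i then (1 / 2 : ℝ) else 1 - 1 / 2) = 1 / 2 ^ n := by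
    intro ω
    norm_num [Finset.prod_const]
  have hcard := Finset.card_filter_add_card_filter_not (s := Finset.univ) P
  simp only [Finset.card_univ, Fintype.card_fun, Fintype.card_bool, Fintype.card_fin] at hcard
  have hcard' : ((Finset.univ.filter P).card : ℝ)
      + ((Finset.univ.filter fun ω => ¬ P ω).card : ℝ) = 2 ^ n := by exact_mod_cast hcard
  simp only [bernoulliProb, hweight]
  rw [← Finset.sum_filter, Finset.sum_const, nsmul_eq_mul, eq_sub_iff_add_eq, mul_one_div,
    ← add_div, hcard', div_self (by positivity)]

/-- Lemma 3.1: if `f` is a multilinear `n`-variable real polynomial of degree exactly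
`d ≥ 1` and `ξ ∈ Ber(1/2)ⁿ`, then for every `ℓ ∈ ℝ`, `Pr(f(ξ) = ℓ) ≤ 1 - 2^{-d}`. -/
theorem unbiased_non_asymptotic (n d : ℕ) (hd : 1 ≤ d)
    (f : MvPolynomial (Fin n) ℝ)
    (hmultilin : ∀ m ∈ f.support, ∀ i, m i ≤ 1)
    (hdeg : f.totalDegree = d) (ℓ : ℝ) :
    bernoulliProb (1 / 2 : ℝ) (fun ω : Fin n → Bool =>
        MvPolynomial.eval (fun i => if ω i then (1:ℝ) else 0) f = ℓ)
      ≤ 1 - 1 / 2 ^ d := by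
  have hf : f.support.Nonempty := by
    rw [Finset.nonempty_iff_ne_empty, Ne, MvPolynomial.support_eq_empty]
    rintro rfl
    simp at hdeg
    omega
  obtain ⟨m₀, hm₀, hmdeg⟩ := Finset.exists_mem_eq_sup f.support hf fun m => m.sum fun _ e => e
  have hsum : ∀ m : Fin n →₀ ℕ, (m.sum fun _ e => e) = ∑ i, m i :=
    fun m => Finsupp.sum_fintype _ _ fun _ => rfl
  have hm₀sum : ∑ i, m₀ i = d := by
    rw [← hsum, ← hmdeg, ← hdeg, MvPolynomial.totalDegree]
  have hmax : ∀ m ∈ f.support, ∑ i, m i ≤ ∑ i, m₀ i := by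
    intro m hm
    rw [hm₀sum, ← hdeg, ← hsum]
    exact MvPolynomial.le_totalDegree hm
  have hcard : m₀.support.card = d := by
    rw [← hm₀sum, ← hsum, Finsupp.sum, Finset.card_eq_sum_ones]
    refine Finset.sum_congr rfl fun i hi => ?_
    have := Finsupp.mem_support_iff.1 hi
    have := hmultilin m₀ hm₀ i
    omega
  have hne : m₀.support.Nonempty := Finset.card_pos.1 (by omega)
  have hcount := two_pow_le_card_mul_of_meets_subcubes m₀.support
    (Finset.univ.filter fun ω : Fin n → Bool =>
      ¬ MvPolynomial.eval (fun i => if ω i then (1 : ℝ) else 0) f = ℓ) fun η => by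
    obtain ⟨ω, hω, hωne⟩ :=
      exists_eval_ne_on_subcube f m₀ hm₀ (hmultilin m₀ hm₀) hne hmax ℓ η
    exact ⟨ω, by simpa using hωne, hω⟩
  rw [hcard] at hcount
  rw [bernoulliProb_half]
  refine sub_le_sub_left ?_ 1
  rw [div_le_div_iff₀ (by positivity) (by positivity), one_mul]
  exact_mod_cast hcount
end

section
/- Fix λ > 0. For each n let a₁,…,aₙ be nonzero real numbers, let ξ ∈ Ber(λ/n)ⁿ, and let X = a₁ξ₁ + ⋯ + aₙξₙ. Then for every ε > 0 there is N (depending only on λ and ε) such that for all n ≥ N, all choices of nonzero a₁,…,aₙ, and all x ∈ ℝ, Pr(X = x) ≤ I₀(λ)·e^{−λ} + ε, where I₀(λ) = Σ_{i=0}^{∞} (λ/2)^{2i}/(i!)² is the modified Bessel function of the first kind evaluated at λ. -/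
open Filter Real
open scoped BigOperators Classical

/-- The time averages of a continuous `2π`-periodic function along `t ↦ a * t`, `a ≠ 0`,
converge to its mean over a period. -/
theorem tendsto_average_periodic {g : ℝ → ℝ} (hg : Continuous g)
    (hper : Function.Periodic g (2 * π)) {a : ℝ} (ha : a ≠ 0) :
    Tendsto (fun T : ℝ => T⁻¹ * ∫ t in (0 : ℝ)..T, g (a * t)) atTop
      (nhds ((2 * π)⁻¹ * ∫ t in (0 : ℝ)..2 * π, g t)) := by
  set m : ℝ := (2 * π)⁻¹ * ∫ t in (0 : ℝ)..2 * π, g t with hm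
  have hπ : (2 * π) ≠ 0 := by positivity
  have hint : ∀ b c : ℝ, IntervalIntegrable g MeasureTheory.volume b c :=
    fun b c => hg.intervalIntegrable b c
  set h : ℝ → ℝ := fun T => (∫ t in (0 : ℝ)..T, g t) - T * m with hh
  have hcont : Continuous h :=
    (intervalIntegral.continuous_primitive hint 0).sub (continuous_id.mul continuous_const)
  have hhper : Function.Periodic h (2 * π) := by
    intro T
    have h1 := intervalIntegral.integral_add_adjacent_intervals (hint 0 T) (hint T (T + 2 * π))
    have h2 := hper.intervalIntegral_add_eq T 0
    have h3 : 2 * π * m = ∫ t in (0 : ℝ)..2 * π, g t := by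
      rw [hm, mul_inv_cancel_left₀ hπ]
    simp only [hh]
    rw [← h1, h2, zero_add, ← h3]
    ring
  obtain ⟨C, hC⟩ : ∃ C, ∀ T, |h T| ≤ C := by
    obtain ⟨C, hC⟩ := (isCompact_Icc (a := (0 : ℝ)) (b := 2 * π)).exists_bound_of_continuousOn
      hcont.continuousOn
    refine ⟨C, fun T => ?_⟩
    obtain ⟨y, hy, hy'⟩ := hhper.exists_mem_Ico₀ (by positivity) T
    rw [hy']
    exact hC y ⟨hy.1, hy.2.le⟩
  have hlim : Tendsto (fun T : ℝ => m + a⁻¹ * (T⁻¹ * h (a * T))) atTop (nhds (m + a⁻¹ * 0)) := by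
    refine tendsto_const_nhds.add (tendsto_const_nhds.mul ?_)
    refine tendsto_inv_atTop_zero.zero_mul_isBoundedUnder_le ?_
    exact isBoundedUnder_of ⟨C, fun T => hC _⟩
  rw [mul_zero, add_zero] at hlim
  refine hlim.congr' ?_
  filter_upwards [eventually_gt_atTop 0] with T hT
  rw [intervalIntegral.integral_comp_mul_left _ ha, mul_zero, smul_eq_mul]
  simp only [hh]
  field_simp
  ring

/-- The time averages of `t ↦ cos (b * t)` detect whether `b = 0`. -/
theorem tendsto_average_cos (b : ℝ) :
    Tendsto (fun T : ℝ => T⁻¹ * ∫ t in (0 : ℝ)..T, cos (b * t)) atTop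
      (nhds (if b = 0 then 1 else 0)) := by
  by_cases hb : b = 0
  · subst hb
    simp only [zero_mul, cos_zero, if_true]
    refine tendsto_const_nhds.congr' ?_
    filter_upwards [eventually_gt_atTop 0] with T hT
    simp [hT.ne']
  · simpa [hb] using tendsto_average_periodic continuous_cos cos_periodic hb

theorem integral_sin_pow_even_div_factorial (x : ℝ) (k : ℕ) :
    ∫ t in (0 : ℝ)..π, (x * sin t) ^ (2 * k) / ((2 * k).factorial : ℝ)
      = π * ((x / 2) ^ (2 * k) / (k.factorial : ℝ) ^ 2) := by
  simp only [mul_pow]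
  rw [intervalIntegral.integral_div, intervalIntegral.integral_const_mul, integral_sin_pow_even]
  induction k with
  | zero => simp
  | succ k ih =>
    rw [Finset.prod_range_succ, show 2 * (k + 1) = 2 * k + 1 + 1 by ring, Nat.factorial_succ,
      Nat.factorial_succ, Nat.factorial_succ]
    push_cast
    have e1 : x ^ (2 * k + 1 + 1) * (π * ((∏ i ∈ Finset.range k, (2 * (i : ℝ) + 1) / (2 * i + 2)) *
        ((2 * (k : ℝ) + 1) / (2 * k + 2)))) / ((2 * (k : ℝ) + 1 + 1) * ((2 * (k : ℝ) + 1) *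
        ((2 * k).factorial : ℝ))) = x ^ (2 * k) * (π * (∏ i ∈ Finset.range k, (2 * (i : ℝ) + 1) /
        (2 * i + 2))) / ((2 * k).factorial : ℝ) * (x ^ 2 / (2 * (k + 1)) ^ 2) := by
      have : (2 * (k : ℝ) + 1) ≠ 0 := by positivity
      have : ((2 * k).factorial : ℝ) ≠ 0 := by positivity
      field_simp
      ring
    rw [e1, ih]
    have : (k.factorial : ℝ) ≠ 0 := by positivity
    field_simp
    ring

theorem integral_cosh_mul_sin (x : ℝ) :
    ∫ t in (0 : ℝ)..π, cosh (x * sin t)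
      = π * ∑' k : ℕ, (x / 2) ^ (2 * k) / (k.factorial : ℝ) ^ 2 := by
  have key : HasSum (fun k : ℕ => ∫ t in (0 : ℝ)..π, (x * sin t) ^ (2 * k) / ((2 * k).factorial : ℝ))
      (∫ t in (0 : ℝ)..π, cosh (x * sin t)) := by
    refine intervalIntegral.hasSum_integral_of_dominated_convergence
      (fun k _ => |x| ^ (2 * k) / ((2 * k).factorial : ℝ)) ?_ ?_ ?_ ?_ ?_
    · intro k
      exact (by fun_prop : Continuous fun t : ℝ => (x * sin t) ^ (2 * k) /
        ((2 * k).factorial : ℝ)).aestronglyMeasurable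
    · intro k
      refine Eventually.of_forall fun t _ => ?_
      rw [norm_div, norm_pow, norm_mul, Real.norm_eq_abs, Real.norm_eq_abs, Real.norm_natCast]
      gcongr
      exact mul_le_of_le_one_right (abs_nonneg x) (abs_sin_le_one t)
    · exact Eventually.of_forall fun t _ => (Real.hasSum_cosh |x|).summable
    · exact intervalIntegrable_const
    · exact Eventually.of_forall fun t _ => Real.hasSum_cosh _
  rw [← key.tsum_eq, ← tsum_mul_left]
  exact tsum_congr fun k => integral_sin_pow_even_div_factorial x k

/-- The integral representation of the modified Bessel function of order `0`. -/
theorem average_exp_mul_cos (x : ℝ) :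
    (2 * π)⁻¹ * ∫ t in (0 : ℝ)..2 * π, exp (x * cos t)
      = ∑' k : ℕ, (x / 2) ^ (2 * k) / (k.factorial : ℝ) ^ 2 := by
  have hc : Continuous fun t : ℝ => exp (x * sin t) := by fun_prop
  have hc' : Continuous fun t : ℝ => exp (-(x * sin t)) := by fun_prop
  have hper : Function.Periodic (fun t : ℝ => exp (x * sin t)) (2 * π) := fun t => by simp
  have h1 : ∫ t in (0 : ℝ)..2 * π, exp (x * cos t) = ∫ t in (0 : ℝ)..2 * π, exp (x * sin t) := by
    have h2 := hper.intervalIntegral_add_eq (π / 2) 0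
    have h3 := intervalIntegral.integral_comp_add_right (a := 0) (b := 2 * π)
      (fun t : ℝ => exp (x * sin t)) (π / 2)
    simp only [sin_add_pi_div_two, zero_add] at h2 h3
    rw [h3, ← h2, add_comm]
  have h4 : ∫ t in π..2 * π, exp (x * sin t) = ∫ t in (0 : ℝ)..π, exp (-(x * sin t)) := by
    have h3 := intervalIntegral.integral_comp_add_right (a := 0) (b := π)
      (fun t : ℝ => exp (x * sin t)) π
    simp only [sin_add_pi, zero_add, mul_neg] at h3
    rw [h3, two_mul]
  rw [h1, ← intervalIntegral.integral_add_adjacent_intervals (hc.intervalIntegrable 0 π)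
    (hc.intervalIntegrable π (2 * π)), h4, ← intervalIntegral.integral_add
    (hc.intervalIntegrable 0 π) (hc'.intervalIntegrable 0 π)]
  have h5 : ∀ t : ℝ, exp (x * sin t) + exp (-(x * sin t)) = 2 * cosh (x * sin t) := fun t => by
    rw [cosh_eq]; ring
  simp only [h5]
  rw [intervalIntegral.integral_const_mul, integral_cosh_mul_sin]
  have := pi_ne_zero
  field_simp

/-- The characteristic function of a Bernoulli variable. -/
theorem norm_bernoulli_char_le (p θ : ℝ) :
    ‖((1 - p : ℝ) : ℂ) + p * Complex.exp (θ * Complex.I)‖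
      ≤ exp (-(p * (1 - p) * (1 - cos θ))) := by
  have hsq : ‖((1 - p : ℝ) : ℂ) + p * Complex.exp (θ * Complex.I)‖ ^ 2
      = 1 - 2 * (p * (1 - p) * (1 - cos θ)) := by
    rw [← Complex.normSq_eq_norm_sq, Complex.normSq_apply]
    simp only [Complex.add_re, Complex.add_im, Complex.ofReal_re, Complex.ofReal_im,
      Complex.re_ofReal_mul, Complex.im_ofReal_mul, Complex.exp_ofReal_mul_I_re,
      Complex.exp_ofReal_mul_I_im]
    linear_combination p ^ 2 * sin_sq_add_cos_sq θ
  refine le_of_sq_le_sq ?_ (exp_pos _).le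
  rw [hsq, ← exp_nat_mul]
  have := add_one_le_exp (-(2 * (p * (1 - p) * (1 - cos θ))))
  calc _ ≤ exp (-(2 * (p * (1 - p) * (1 - cos θ)))) := by linarith
    _ = _ := by congr 1; push_cast; ring

theorem sum_bernoulli_cos_le {ι : Type*} [Fintype ι] [DecidableEq ι] (p : ℝ) (a : ι → ℝ)
    (x t : ℝ) :
    ∑ ω : ι → Bool, (∏ i, if ω i then p else 1 - p) *
        cos ((∑ i, a i * (if ω i then (1 : ℝ) else 0) - x) * t)
      ≤ exp (∑ i, -(p * (1 - p) * (1 - cos (a i * t)))) := by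
  have hexp : (∏ i, (((1 - p : ℝ) : ℂ) + p * Complex.exp ((a i * t : ℝ) * Complex.I))) *
      Complex.exp ((-(x * t) : ℝ) * Complex.I)
      = ∑ ω : ι → Bool, ((∏ i, if ω i then p else 1 - p : ℝ) : ℂ) *
        Complex.exp ((((∑ i, a i * (if ω i then (1 : ℝ) else 0) - x) * t : ℝ) : ℂ) * Complex.I) := by
    have h1 := Finset.prod_univ_sum (fun _ : ι => (Finset.univ : Finset Bool))
      (fun i b => if b then (p : ℂ) * Complex.exp ((a i * t : ℝ) * Complex.I)
        else ((1 - p : ℝ) : ℂ))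
    simp only [Fintype.sum_bool, if_true, Bool.false_eq_true, if_false, Fintype.piFinset_univ] at h1
    simp only [add_comm ((1 - p : ℝ) : ℂ)]
    rw [h1, Finset.sum_mul]
    refine Finset.sum_congr rfl fun ω _ => ?_
    have h2 : (((∑ i, a i * (if ω i then (1 : ℝ) else 0) - x) * t : ℝ) : ℂ) * Complex.I
        = (∑ i, ((a i * (if ω i then (1 : ℝ) else 0) * t : ℝ) : ℂ) * Complex.I)
          + (-(x * t) : ℝ) * Complex.I := by
      rw [← Finset.sum_mul, ← Complex.ofReal_sum, ← Finset.sum_mul]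
      push_cast
      ring
    rw [h2, Complex.exp_add, Complex.exp_sum, ← mul_assoc, Complex.ofReal_prod,
      ← Finset.prod_mul_distrib]
    congr 1
    refine Finset.prod_congr rfl fun i _ => ?_
    cases ω i <;> simp
  calc _ = (∑ ω : ι → Bool, ((∏ i, if ω i then p else 1 - p : ℝ) : ℂ) * Complex.exp
          ((((∑ i, a i * (if ω i then (1 : ℝ) else 0) - x) * t : ℝ) : ℂ) * Complex.I)).re := by
        rw [Complex.re_sum]
        refine Finset.sum_congr rfl fun ω _ => ?_
        rw [Complex.re_ofReal_mul, Complex.exp_ofReal_mul_I_re]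
    _ ≤ ‖(∏ i, (((1 - p : ℝ) : ℂ) + p * Complex.exp ((a i * t : ℝ) * Complex.I))) *
          Complex.exp ((-(x * t) : ℝ) * Complex.I)‖ := by
        rw [← hexp]; exact Complex.re_le_norm _
    _ = ∏ i, ‖((1 - p : ℝ) : ℂ) + p * Complex.exp ((a i * t : ℝ) * Complex.I)‖ := by
        rw [norm_mul, Complex.norm_exp_ofReal_mul_I, mul_one, norm_prod]
    _ ≤ _ := by
        rw [exp_sum]
        exact Finset.prod_le_prod (fun _ _ => norm_nonneg _)
          fun i _ => norm_bernoulli_char_le p (a i * t)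

/-- Jensen's inequality reduces the product of the characteristic functions to an average. -/
theorem exp_sum_bernoulli_le {n : ℕ} (hn : 0 < n) (lam : ℝ) (θ : Fin n → ℝ) :
    exp (∑ i, -(lam / n * (1 - lam / n) * (1 - cos (θ i))))
      ≤ exp (2 * lam ^ 2 / n) * exp (-lam) * ((n : ℝ)⁻¹ * ∑ i, exp (lam * cos (θ i))) := by
  have hn' : (0 : ℝ) < n := by exact_mod_cast hn
  have hJ := convexOn_exp.map_sum_le (t := Finset.univ) (w := fun _ : Fin n => (n : ℝ)⁻¹)
    (p := fun i => lam * cos (θ i)) (fun _ _ => by positivity)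
    (by simp [hn'.ne']) (fun _ _ => Set.mem_univ _)
  simp only [smul_eq_mul, ← Finset.mul_sum] at hJ
  refine le_trans ?_ (mul_le_mul_of_nonneg_left hJ (by positivity))
  rw [← exp_add, ← exp_add, exp_le_exp]
  have hb : ∀ i ∈ Finset.univ, -(lam / n * (1 - lam / n) * (1 - cos (θ i)))
      ≤ 2 * lam ^ 2 / (n : ℝ) ^ 2 + -lam / n + (n : ℝ)⁻¹ * (lam * cos (θ i)) := by
    intro i _
    have : lam ^ 2 / (n : ℝ) ^ 2 * (1 - cos (θ i)) ≤ lam ^ 2 / (n : ℝ) ^ 2 * 2 :=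
      mul_le_mul_of_nonneg_left (by linarith [neg_one_le_cos (θ i)]) (by positivity)
    have e : -(lam / n * (1 - lam / n) * (1 - cos (θ i))) = lam ^ 2 / (n : ℝ) ^ 2 * (1 - cos (θ i))
      + -lam / n + (n : ℝ)⁻¹ * (lam * cos (θ i)) := by
      field_simp
      ring
    rw [e]
    linarith [show 2 * lam ^ 2 / (n : ℝ) ^ 2 = lam ^ 2 / (n : ℝ) ^ 2 * 2 by ring]
  refine (Finset.sum_le_sum hb).trans_eq ?_
  rw [Finset.sum_add_distrib, Finset.sum_const, Finset.card_univ, Fintype.card_fin, nsmul_eq_mul,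
    ← Finset.mul_sum, ← Finset.mul_sum]
  field_simp

theorem bernoulliProb_sum_eq_le {n : ℕ} (hn : 0 < n) (lam : ℝ) (a : Fin n → ℝ)
    (ha : ∀ i, a i ≠ 0) (x : ℝ) :
    bernoulliProb (lam / n) (fun ω : Fin n → Bool =>
        (∑ i, a i * (if ω i then (1 : ℝ) else 0)) = x)
      ≤ exp (2 * lam ^ 2 / n) *
        ((∑' i : ℕ, (lam / 2) ^ (2 * i) / ((Nat.factorial i : ℝ)) ^ 2) * exp (-lam)) := by
  set p : ℝ := lam / n with hp
  set B : ℝ := ∑' i : ℕ, (lam / 2) ^ (2 * i) / ((Nat.factorial i : ℝ)) ^ 2 with hB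
  have hn' : (n : ℝ) ≠ 0 := by exact_mod_cast hn.ne'
  set w : (Fin n → Bool) → ℝ := fun ω => ∏ i, if ω i then p else 1 - p with hw
  set S : (Fin n → Bool) → ℝ := fun ω => ∑ i, a i * (if ω i then (1 : ℝ) else 0) with hS
  have hleft : Tendsto (fun T : ℝ => ∑ ω, w ω * (T⁻¹ * ∫ t in (0 : ℝ)..T, cos ((S ω - x) * t)))
      atTop (nhds (∑ ω, w ω * (if S ω - x = 0 then 1 else 0))) :=
    tendsto_finsetSum _ fun ω _ => tendsto_const_nhds.mul (tendsto_average_cos _)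
  have hright : Tendsto (fun T : ℝ => exp (2 * lam ^ 2 / n) * exp (-lam) *
      ((n : ℝ)⁻¹ * ∑ i, T⁻¹ * ∫ t in (0 : ℝ)..T, exp (lam * cos (a i * t)))) atTop
      (nhds (exp (2 * lam ^ 2 / n) * exp (-lam) * ((n : ℝ)⁻¹ * ∑ _i : Fin n, B))) := by
    refine tendsto_const_nhds.mul (tendsto_const_nhds.mul (tendsto_finsetSum _ fun i _ => ?_))
    rw [hB, ← average_exp_mul_cos]
    exact tendsto_average_periodic (g := fun t => exp (lam * cos t)) (by fun_prop)
      (fun t => by simp) (ha i)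
  have hle := le_of_tendsto_of_tendsto hleft hright (by
    filter_upwards [eventually_gt_atTop 0] with T hT
    have hL : ∑ ω, w ω * (T⁻¹ * ∫ t in (0 : ℝ)..T, cos ((S ω - x) * t))
        = T⁻¹ * ∫ t in (0 : ℝ)..T, ∑ ω, w ω * cos ((S ω - x) * t) := by
      rw [intervalIntegral.integral_finsetSum fun ω _ =>
        (by fun_prop : Continuous fun t : ℝ => w ω * cos ((S ω - x) * t)).intervalIntegrable _ _,
        Finset.mul_sum]
      refine Finset.sum_congr rfl fun ω _ => ?_
      rw [intervalIntegral.integral_const_mul]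
      ring
    have hR : exp (2 * lam ^ 2 / n) * exp (-lam) *
        ((n : ℝ)⁻¹ * ∑ i, T⁻¹ * ∫ t in (0 : ℝ)..T, exp (lam * cos (a i * t)))
        = T⁻¹ * ∫ t in (0 : ℝ)..T, exp (2 * lam ^ 2 / n) * exp (-lam) *
          ((n : ℝ)⁻¹ * ∑ i, exp (lam * cos (a i * t))) := by
      rw [intervalIntegral.integral_const_mul, intervalIntegral.integral_const_mul,
        intervalIntegral.integral_finsetSum fun i _ => (by fun_prop : Continuous fun t : ℝ =>
          exp (lam * cos (a i * t))).intervalIntegrable _ _, ← Finset.mul_sum]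
      ring
    rw [hL, hR]
    refine mul_le_mul_of_nonneg_left ?_ (by positivity)
    refine intervalIntegral.integral_mono_on hT.le
      ((by fun_prop : Continuous _).intervalIntegrable _ _)
      ((by fun_prop : Continuous _).intervalIntegrable _ _) fun t _ => ?_
    exact (sum_bernoulli_cos_le p a x t).trans (exp_sum_bernoulli_le hn lam fun i => a i * t))
  calc _ = ∑ ω, w ω * (if S ω - x = 0 then 1 else 0) := by
        unfold bernoulliProb
        refine Finset.sum_congr rfl fun ω _ => ?_
        simp only [sub_eq_zero, mul_ite, mul_one, mul_zero, hw, hS]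
    _ ≤ _ := hle
    _ = _ := by
        rw [Finset.sum_const, Finset.card_univ, Fintype.card_fin, nsmul_eq_mul,
          inv_mul_cancel_left₀ hn']
        ring

/-- Proposition 7.1 (Bessel bound): fix `λ > 0`.  For every `ε > 0` there is `N` such
that for all `n ≥ N`, all nonzero reals `a₁,…,aₙ`, and all `x ∈ ℝ`, with
`ξ ∈ Ber(λ/n)ⁿ` and `X = a₁ξ₁ + ⋯ + aₙξₙ`, we have
`Pr(X = x) ≤ I₀(λ)e^{-λ} + ε`, where `I₀(λ) = Σ_{i≥0} (λ/2)^{2i}/(i!)²`. -/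
theorem bessel_bound (lam : ℝ) (hlam : 0 < lam) :
    ∀ ε : ℝ, 0 < ε → ∃ N : ℕ, ∀ n : ℕ, N ≤ n →
      ∀ a : Fin n → ℝ, (∀ i, a i ≠ 0) → ∀ x : ℝ,
        bernoulliProb (lam / n) (fun ω : Fin n → Bool =>
            (∑ i, a i * (if ω i then (1:ℝ) else 0)) = x)
          ≤ (∑' i : ℕ, (lam / 2) ^ (2 * i) / ((Nat.factorial i : ℝ)) ^ 2)
              * Real.exp (-lam) + ε := by
  intro ε hε
  set B : ℝ := ∑' i : ℕ, (lam / 2) ^ (2 * i) / ((Nat.factorial i : ℝ)) ^ 2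
  have hlim : Tendsto (fun n : ℕ => exp (2 * lam ^ 2 / n) * (B * exp (-lam))) atTop
      (nhds (exp 0 * (B * exp (-lam)))) :=
    ((continuous_exp.tendsto 0).comp (tendsto_const_div_atTop_nhds_zero_nat _)).mul_const _
  rw [exp_zero, one_mul] at hlim
  obtain ⟨N, hN⟩ := eventually_atTop.1
    ((hlim.eventually_le_const (lt_add_of_pos_right _ hε)).and (eventually_gt_atTop 0))
  exact ⟨N, fun n hn a ha x =>
    (bernoulliProb_sum_eq_le (hN n hn).2 lam a ha x).trans (hN n hn).1⟩
end

section
/- Let ξ ∈ Ber(1/n)ⁿ and let X = Σ_{i=1}^{n} ξᵢ − Σ_{1≤i<j≤n} ξᵢξⱼ. Then Pr(X = 1) → 3/(2e) as n → ∞. -/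
open Filter Real
open scoped BigOperators Classical

open Finset in
lemma two_mul_sum_lt_mul {ι R : Type*} [Fintype ι] [LinearOrder ι] [CommRing R] (f : ι → R)
    (hf : ∀ i, f i * f i = f i) :
    2 * ∑ q ∈ univ.filter (fun q : ι × ι => q.1 < q.2), f q.1 * f q.2
      = (∑ i, f i) * (∑ i, f i) - ∑ i, f i := by
  have h_swap : ∑ q ∈ univ.filter (fun q : ι × ι => q.2 < q.1), f q.1 * f q.2
      = ∑ q ∈ univ.filter (fun q : ι × ι => q.1 < q.2), f q.1 * f q.2 :=
    sum_nbij' Prod.swap Prod.swap (by simp) (by simp) (by simp) (by simp)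
      (fun q _ => mul_comm _ _)
  have h_diag : ∑ q : ι × ι, (if q.1 = q.2 then f q.1 * f q.2 else 0) = ∑ i, f i := by
    simp [Fintype.sum_prod_type, hf]
  have h_total : (∑ i, f i) * (∑ i, f i)
      = ∑ q ∈ univ.filter (fun q : ι × ι => q.1 < q.2), f q.1 * f q.2
        + ∑ q ∈ univ.filter (fun q : ι × ι => q.2 < q.1), f q.1 * f q.2
        + ∑ q : ι × ι, (if q.1 = q.2 then f q.1 * f q.2 else 0) := by
    rw [sum_mul_sum, ← Fintype.sum_prod_type' (fun i j => f i * f j), sum_filter, sum_filter,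
      ← sum_add_distrib, ← sum_add_distrib]
    refine sum_congr rfl fun q _ => ?_
    rcases lt_trichotomy q.1 q.2 with h | h | h
    · simp [h, h.not_gt, h.ne]
    · simp [h]
    · simp [h, h.not_gt, h.ne']
  rw [h_total, h_swap, h_diag]
  ring

open Finset in
/-- An event depending only on the number of successes has its binomial probability. -/
lemma bernoulliProb_card_eq {ι : Type*} [Fintype ι] [DecidableEq ι] (p : ℝ) (Q : ℕ → Prop) :
    bernoulliProb p (fun ω : ι → Bool => Q #{i | ω i = true})
      = ∑ k ∈ range (Fintype.card ι + 1),
          (Fintype.card ι).choose k * if Q k then p ^ k * (1 - p) ^ (Fintype.card ι - k) else 0 := by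
  have h := sum_powerset_apply_card (x := (univ : Finset ι))
    (fun k => if Q k then p ^ k * (1 - p) ^ (Fintype.card ι - k) else 0)
  simp only [card_univ, nsmul_eq_mul, powerset_univ] at h
  rw [← h, bernoulliProb]
  refine sum_bij' (fun ω _ => univ.filter (fun i => ω i = true)) (fun s _ i => decide (i ∈ s))
    (by simp) (by simp) (by simp) (by simp) (fun ω _ => ?_)
  have h_compl : #{i | ¬ ω i = true} = Fintype.card ι - #{i | ω i = true} := by
    rw [← card_univ, ← card_filter_add_card_filter_not (s := univ) (fun i => ω i = true)]
    simp
  rw [prod_ite, prod_const, prod_const, h_compl]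

lemma natCast_sub_sq_div_two_eq_one_iff (k : ℕ) :
    (k : ℝ) - ((k : ℝ) * k - k) / 2 = 1 ↔ k = 1 ∨ k = 2 := by
  constructor
  · intro h
    have h_prod : ((k : ℝ) - 1) * ((k : ℝ) - 2) = 0 := by linarith
    rcases mul_eq_zero.mp h_prod with h' | h'
    · left; exact_mod_cast sub_eq_zero.mp h'
    · right; exact_mod_cast sub_eq_zero.mp h'
  · rintro (rfl | rfl) <;> norm_num

lemma bernoulliProb_card_eq_one_or_two {n : ℕ} (hn : 2 ≤ n) (p : ℝ) :
    bernoulliProb p (fun ω : Fin n → Bool =>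
        Finset.card {i | ω i = true} = 1 ∨ Finset.card {i | ω i = true} = 2)
      = n * (p * (1 - p) ^ (n - 1)) + n.choose 2 * (p ^ 2 * (1 - p) ^ (n - 2)) := by
  rw [bernoulliProb_card_eq p (fun k => k = 1 ∨ k = 2), Fintype.card_fin]
  have h_sub : ({1, 2} : Finset ℕ) ⊆ Finset.range (n + 1) := by
    intro k
    simp only [Finset.mem_insert, Finset.mem_singleton, Finset.mem_range]
    omega
  rw [← Finset.sum_subset h_sub, Finset.sum_pair (by norm_num)]
  · simp
  · intro k _ hk
    simp only [Finset.mem_insert, Finset.mem_singleton] at hk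
    simp [hk]

lemma sum_sub_sum_lt_mul_eq_one_iff {n : ℕ} (ω : Fin n → Bool) :
    (∑ i, (if ω i then (1:ℝ) else 0))
          - (∑ q ∈ Finset.univ.filter (fun q : Fin n × Fin n => q.1 < q.2),
              (if ω q.1 then (1:ℝ) else 0) * (if ω q.2 then (1:ℝ) else 0)) = 1
      ↔ Finset.card {i | ω i = true} = 1 ∨ Finset.card {i | ω i = true} = 2 := by
  have h_pairs := two_mul_sum_lt_mul (fun i => if ω i then (1:ℝ) else 0) (by simp)
  have h_card : ∑ i, (if ω i then (1:ℝ) else 0) = Finset.card {i | ω i = true} := by simp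
  rw [h_card] at h_pairs ⊢
  rw [← natCast_sub_sq_div_two_eq_one_iff, ← h_pairs, mul_div_cancel_left₀ _ two_ne_zero]

/-- With `ξ ∈ Ber(1/n)ⁿ` and `X = Σᵢ ξᵢ − Σ_{i<j} ξᵢξⱼ`, we have
`Pr(X = 1) → 3/(2e)` as `n → ∞`. -/
theorem quadratic_example :
    Filter.Tendsto (fun n : ℕ =>
      bernoulliProb (1 / (n : ℝ)) (fun ω : Fin n → Bool =>
        (∑ i, (if ω i then (1:ℝ) else 0))
          - (∑ q ∈ Finset.univ.filter (fun q : Fin n × Fin n => q.1 < q.2),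
              (if ω q.1 then (1:ℝ) else 0) * (if ω q.2 then (1:ℝ) else 0)) = 1))
      Filter.atTop (nhds (3 / (2 * Real.exp 1))) := by
  simp only [sum_sub_sum_lt_mul_eq_one_iff]
  have h_inv : Tendsto (fun n : ℕ => 1 + (-1 : ℝ) / n) atTop (nhds 1) := by
    simpa using (tendsto_const_div_atTop_nhds_zero_nat (-1 : ℝ)).const_add 1
  have h_lim := ((tendsto_one_add_div_pow_exp (-1)).div h_inv one_ne_zero).const_mul (3 / 2)
  have h_val : 3 / 2 * (Real.exp (-1) / 1) = 3 / (2 * Real.exp 1) := by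
    rw [Real.exp_neg]
    field_simp
  rw [h_val] at h_lim
  refine h_lim.congr' ?_
  filter_upwards [eventually_ge_atTop 2] with n hn
  rw [bernoulliProb_card_eq_one_or_two hn, Nat.cast_choose_two]
  obtain ⟨m, rfl⟩ := Nat.exists_eq_add_of_le' hn
  have h_pos : (0 : ℝ) < ((m + 2 : ℕ) : ℝ) := by positivity
  have h_base : 1 + (-1 : ℝ) / ((m + 2 : ℕ) : ℝ) = 1 - 1 / ((m + 2 : ℕ) : ℝ) := by ring
  have h_ne : 1 - 1 / ((m + 2 : ℕ) : ℝ) ≠ 0 := by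
    rw [one_sub_div h_pos.ne']
    push_cast
    have : (m : ℝ) + 2 - 1 ≠ 0 := by
      have := m.cast_nonneg (α := ℝ)
      linarith
    positivity
  simp only [Pi.div_apply, h_base]
  set x : ℝ := ((m + 2 : ℕ) : ℝ) with hx
  set y : ℝ := 1 - 1 / x with hy
  have h_xy : x - 1 = x * y := by
    rw [hy]
    field_simp
  rw [h_xy, show m + 2 - 1 = m + 1 by omega, show m + 2 - 2 = m by omega]
  field_simp
  ring
end
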